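/- arXiv:1311.5046 — 7 statements merged into one kernel-verified Lean document; each statement's English description precedes it below -/
import Mathlib

section
/- For integers n, m ≥ 2 and every μ ≤ min{m, n}, the complete bipartite graph K_{n,m} admits a μ-simultaneous edge coloring; moreover, χ'_{μ-SE}(K_{n,m}) = max{m, n}. -/
open SimpleGraph

/-- A proper edge coloring of `G`: incident distinct edges receive different colors. -/
def IsProperEdgeColoring {V : Type*} (G : SimpleGraph V) (c : Sym2 V → ℕ) : Prop :=
  ∀ e₁ ∈ G.edgeSet, ∀ e₂ ∈ G.edgeSet, e₁ ≠ e₂ → (∃ v, v ∈ e₁ ∧ v ∈ e₂) → c e₁ ≠ c e₂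

/-- The set of colors appearing on the edges of `G` incident to the vertex `v`. -/
def colorsAt {V : Type*} (G : SimpleGraph V) (c : Sym2 V → ℕ) (v : V) : Set ℕ :=
  {k | ∃ e ∈ G.edgeSet, v ∈ e ∧ c e = k}

/-- A `μ`-simultaneous edge coloring of `G`: `μ` proper edge colorings such that at every
vertex the set of colors appearing on its incident edges is the same in all colorings, and
no edge gets the same color in two different colorings. -/
def IsSimultaneousEdgeColoring {V : Type*} (G : SimpleGraph V) (μ : ℕ)
    (c : Fin μ → Sym2 V → ℕ) : Prop :=
  (∀ i, IsProperEdgeColoring G (c i)) ∧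
  (∀ i j : Fin μ, ∀ v : V, colorsAt G (c i) v = colorsAt G (c j) v) ∧
  (∀ i j : Fin μ, i ≠ j → ∀ e ∈ G.edgeSet, c i e ≠ c j e)

/-- `G` admits a `μ`-simultaneous edge coloring. -/
def SimultaneousEdgeColorable {V : Type*} (G : SimpleGraph V) (μ : ℕ) : Prop :=
  ∃ c : Fin μ → Sym2 V → ℕ, IsSimultaneousEdgeColoring G μ c

/-- The `μ`-SE chromatic number of `G`: the least `l` such that `G` has a `μ`-simultaneous
edge coloring using colors from `{1, …, l}`. -/
noncomputable def simSEChromaticNumber {V : Type*} (G : SimpleGraph V) (μ : ℕ) : ℕ :=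
  sInf {l | ∃ c : Fin μ → Sym2 V → ℕ, IsSimultaneousEdgeColoring G μ c ∧
    ∀ (i : Fin μ), ∀ e ∈ G.edgeSet, c i e ∈ Set.Icc 1 l}

/-- The edge coloring of a complete bipartite graph whose color on the edge `ab` is the entry
`L a b` of an array. -/
def arrayColoring {α β : Type*} (L : α → β → ℕ) : Sym2 (α ⊕ β) → ℕ :=
  Sym2.lift ⟨fun
    | .inl a, .inr b => L a b
    | .inr b, .inl a => L a b
    | _, _ => 0, by rintro (a | b) (a' | b') <;> rfl⟩

@[simp]
theorem arrayColoring_mk {α β : Type*} (L : α → β → ℕ) (a : α) (b : β) :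
    arrayColoring L s(.inl a, .inr b) = L a b := rfl

theorem mem_edgeSet_completeBipartiteGraph {α β : Type*} {e : Sym2 (α ⊕ β)} :
    e ∈ (completeBipartiteGraph α β).edgeSet ↔ ∃ a b, e = s(.inl a, .inr b) := by
  constructor
  · induction e with | _ x y
    rcases x with a | b <;> rcases y with a' | b' <;> simp
  · rintro ⟨a, b, rfl⟩
    simp

theorem colorsAt_arrayColoring_inl {α β : Type*} (L : α → β → ℕ) (a : α) :
    colorsAt (completeBipartiteGraph α β) (arrayColoring L) (.inl a) = Set.range (L a) := by
  ext k
  simp only [colorsAt, mem_edgeSet_completeBipartiteGraph, Set.mem_ofPred_eq, Set.mem_range]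
  constructor
  · rintro ⟨_, ⟨a', b, rfl⟩, ha, rfl⟩
    obtain rfl : a = a' := by simpa using ha
    exact ⟨b, rfl⟩
  · rintro ⟨b, rfl⟩
    exact ⟨_, ⟨a, b, rfl⟩, by simp, rfl⟩

theorem colorsAt_arrayColoring_inr {α β : Type*} (L : α → β → ℕ) (b : β) :
    colorsAt (completeBipartiteGraph α β) (arrayColoring L) (.inr b) =
      Set.range fun a => L a b := by
  ext k
  simp only [colorsAt, mem_edgeSet_completeBipartiteGraph, Set.mem_ofPred_eq, Set.mem_range]
  constructor
  · rintro ⟨_, ⟨a, b', rfl⟩, hb, rfl⟩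
    obtain rfl : b = b' := by simpa using hb
    exact ⟨a, rfl⟩
  · rintro ⟨a, rfl⟩
    exact ⟨_, ⟨a, b, rfl⟩, by simp, rfl⟩

theorem isProperEdgeColoring_arrayColoring {α β : Type*} {L : α → β → ℕ}
    (hrow : ∀ a, (L a).Injective) (hcol : ∀ b, (fun a => L a b).Injective) :
    IsProperEdgeColoring (completeBipartiteGraph α β) (arrayColoring L) := by
  intro e₁ h₁ e₂ h₂ hne ⟨v, hv₁, hv₂⟩ heq
  obtain ⟨a₁, b₁, rfl⟩ := mem_edgeSet_completeBipartiteGraph.1 h₁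
  obtain ⟨a₂, b₂, rfl⟩ := mem_edgeSet_completeBipartiteGraph.1 h₂
  simp only [arrayColoring_mk] at heq
  rcases v with a | b
  · obtain rfl : a = a₁ := by simpa using hv₁
    obtain rfl : a = a₂ := by simpa using hv₂
    exact hne (by rw [hrow a heq])
  · obtain rfl : b = b₁ := by simpa using hv₁
    obtain rfl : b = b₂ := by simpa using hv₂
    exact hne (by rw [hcol b heq])

/-- Cyclically shifting the rows of an `n × m` cyclic Latin rectangle yields `μ ≤ n` Latin
rectangles with the same row and column sets, no two of which agree in a cell. -/
theorem exists_latin_rectangles {n m μ : ℕ} (hn : 0 < n) (hnm : n ≤ m) (hμ : μ ≤ n) :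
    ∃ L : Fin μ → Fin n → Fin m → ℕ,
      (∀ i a, (L i a).Injective) ∧ (∀ i b, (fun a => L i a b).Injective) ∧
      (∀ i j a, Set.range (L i a) = Set.range (L j a)) ∧
      (∀ i j b, (Set.range fun a => L i a b) = Set.range fun a => L j a b) ∧
      (∀ i j, i ≠ j → ∀ a b, L i a b ≠ L j a b) ∧
      ∀ i a b, L i a b ∈ Set.Icc 1 m := by
  have : NeZero n := ⟨by omega⟩
  have : NeZero m := ⟨by omega⟩
  let color : Fin m → ℕ := fun k => k + 1
  have hcolor : color.Injective := fun x y h => Fin.ext (Nat.succ_injective h)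
  let L₀ : Fin n → Fin m → ℕ := fun a b => color (Fin.castLE hnm a + b)
  have hcol (b : Fin m) : (fun a => L₀ a b).Injective := fun x y h =>
    Fin.castLE_injective hnm (add_right_cancel (hcolor h))
  have hrange (a : Fin n) : Set.range (L₀ a) = Set.range color :=
    (Equiv.addLeft (Fin.castLE hnm a)).surjective.range_comp color
  have hshift (k : Fin n) (b : Fin m) :
      (Set.range fun a => L₀ (a + k) b) = Set.range fun a => L₀ a b :=
    (Equiv.addRight k).surjective.range_comp fun a => L₀ a b
  refine ⟨fun i a b => L₀ (a + Fin.castLE hμ i) b, fun i a x y h => add_left_cancel (hcolor h),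
    fun i b x y h => add_right_cancel (hcol b h), fun i j a => (hrange _).trans (hrange _).symm,
    fun i j b => (hshift _ b).trans (hshift _ b).symm,
    fun i j hij a b h => hij (Fin.castLE_injective hμ (add_left_cancel (hcol b h))),
    fun i a b => ⟨Nat.succ_pos _, Fin.is_lt _⟩⟩

theorem exists_isSimultaneousEdgeColoring_completeBipartiteGraph {n m μ : ℕ} (hn : 0 < n)
    (hm : 0 < m) (hμ : μ ≤ min m n) :
    ∃ c : Fin μ → Sym2 (Fin n ⊕ Fin m) → ℕ,
      IsSimultaneousEdgeColoring (completeBipartiteGraph (Fin n) (Fin m)) μ c ∧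
      ∀ i, ∀ e ∈ (completeBipartiteGraph (Fin n) (Fin m)).edgeSet,
        c i e ∈ Set.Icc 1 (max m n) := by
  obtain ⟨L, hrow, hcol, hrows, hcols, hne, hIcc⟩ : ∃ L : Fin μ → Fin n → Fin m → ℕ,
      (∀ i a, (L i a).Injective) ∧ (∀ i b, (fun a => L i a b).Injective) ∧
      (∀ i j a, Set.range (L i a) = Set.range (L j a)) ∧
      (∀ i j b, (Set.range fun a => L i a b) = Set.range fun a => L j a b) ∧
      (∀ i j, i ≠ j → ∀ a b, L i a b ≠ L j a b) ∧
      ∀ i a b, L i a b ∈ Set.Icc 1 (max m n) := by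
    rcases le_total n m with h | h
    · rw [max_eq_left h]
      exact exists_latin_rectangles hn h (hμ.trans (min_le_right _ _))
    · rw [max_eq_right h]
      obtain ⟨L, hrow, hcol, hrows, hcols, hne, hIcc⟩ :=
        exists_latin_rectangles hm h (hμ.trans (min_le_left _ _))
      exact ⟨fun i a b => L i b a, hcol, hrow, hcols, hrows,
        fun i j hij a b => hne i j hij b a, fun i a b => hIcc i b a⟩
  refine ⟨fun i => arrayColoring (L i),
    ⟨fun i => isProperEdgeColoring_arrayColoring (hrow i) (hcol i), ?_, ?_⟩, ?_⟩
  · rintro i j (a | b)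
    · simpa only [colorsAt_arrayColoring_inl] using hrows i j a
    · simpa only [colorsAt_arrayColoring_inr] using hcols i j b
  · intro i j hij e he
    obtain ⟨a, b, rfl⟩ := mem_edgeSet_completeBipartiteGraph.1 he
    exact hne i j hij a b
  · intro i e he
    obtain ⟨a, b, rfl⟩ := mem_edgeSet_completeBipartiteGraph.1 he
    exact hIcc i a b

theorem card_le_of_injective_of_mem_Icc {k l : ℕ} {f : Fin k → ℕ} (hf : f.Injective)
    (h : ∀ x, f x ∈ Set.Icc 1 l) : k ≤ l := by
  simpa using Finset.card_le_card_of_injOn (s := Finset.univ) (t := Finset.Icc 1 l) f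
    (fun x _ => by simpa using h x) hf.injOn

/-- A proper edge coloring of `K_{n,m}` uses at least `max {m, n}` colors. -/
theorem IsProperEdgeColoring.max_le {n m l : ℕ} (hn : 0 < n) (hm : 0 < m)
    {c : Sym2 (Fin n ⊕ Fin m) → ℕ}
    (hc : IsProperEdgeColoring (completeBipartiteGraph (Fin n) (Fin m)) c)
    (hl : ∀ e ∈ (completeBipartiteGraph (Fin n) (Fin m)).edgeSet, c e ∈ Set.Icc 1 l) :
    max m n ≤ l := by
  have hmem (a : Fin n) (b : Fin m) :
      s(.inl a, .inr b) ∈ (completeBipartiteGraph (Fin n) (Fin m)).edgeSet :=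
    mem_edgeSet_completeBipartiteGraph.2 ⟨a, b, rfl⟩
  refine _root_.max_le ?_ ?_
  · refine card_le_of_injective_of_mem_Icc (f := fun b => c s(.inl ⟨0, hn⟩, .inr b)) ?_
      fun b => hl _ (hmem _ b)
    intro x y hxy
    by_contra hne
    exact hc _ (hmem _ x) _ (hmem _ y) (by simpa using hne) ⟨.inl ⟨0, hn⟩, by simp⟩ hxy
  · refine card_le_of_injective_of_mem_Icc (f := fun a => c s(.inl a, .inr ⟨0, hm⟩)) ?_
      fun a => hl _ (hmem a _)
    intro x y hxy
    by_contra hne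
    exact hc _ (hmem x _) _ (hmem y _) (by simpa using hne) ⟨.inr ⟨0, hm⟩, by simp⟩ hxy

/-- For `n, m ≥ 2` and every `1 ≤ μ ≤ min {m, n}`, the complete bipartite graph `K_{n,m}`
admits a `μ`-simultaneous edge coloring; moreover `χ'_{μ-SE}(K_{n,m}) = max {m, n}`. -/
theorem completeBipartiteGraph_simultaneousEdgeColorable
    (n m μ : ℕ) (hn : 2 ≤ n) (hm : 2 ≤ m) (hμ1 : 1 ≤ μ) (hμ : μ ≤ min m n) :
    SimultaneousEdgeColorable (completeBipartiteGraph (Fin n) (Fin m)) μ ∧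
      simSEChromaticNumber (completeBipartiteGraph (Fin n) (Fin m)) μ = max m n := by
  obtain ⟨c, hc, hIcc⟩ :=
    exists_isSimultaneousEdgeColoring_completeBipartiteGraph (n := n) (m := m) (by omega)
      (by omega) hμ
  refine ⟨⟨c, hc⟩, IsLeast.csInf_eq ⟨⟨c, hc, hIcc⟩, ?_⟩⟩
  rintro l ⟨d, hd, hl⟩
  exact (hd.1 ⟨0, hμ1⟩).max_le (by omega) (by omega) (hl ⟨0, hμ1⟩)
end

section
/- The complete graph K_7 admits a μ-simultaneous edge coloring for μ = 2 and for μ = 3. -/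
open SimpleGraph

/-- Restricting a simultaneous edge coloring to fewer colorings. -/
theorem SimultaneousEdgeColorable.mono {V : Type*} {G : SimpleGraph V} {μ ν : ℕ} (h : ν ≤ μ)
    (hG : SimultaneousEdgeColorable G μ) : SimultaneousEdgeColorable G ν := by
  obtain ⟨c, proper, colors, disjoint⟩ := hG
  exact ⟨fun i => c (i.castLE h), fun i => proper _, fun i j => colors _ _,
    fun i j hij => disjoint _ _ ((Fin.castLE_injective h).ne hij)⟩

/-- A coloring is proper if edges at a vertex with the same color have the same other end. -/
theorem isProperEdgeColoring_of_injective {V : Type*} {G : SimpleGraph V} {c : Sym2 V → ℕ}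
    (h : ∀ v x y, G.Adj v x → G.Adj v y → c s(v, x) = c s(v, y) → x = y) :
    IsProperEdgeColoring G c := by
  rintro e₁ he₁ e₂ he₂ hne ⟨v, hv₁, hv₂⟩ hc
  obtain ⟨x, rfl⟩ := hv₁
  obtain ⟨y, rfl⟩ := hv₂
  exact hne (by rw [h v x y he₁ he₂ hc])

theorem mem_colorsAt {V : Type*} {G : SimpleGraph V} {c : Sym2 V → ℕ} {v : V} {k : ℕ} :
    k ∈ colorsAt G c v ↔ ∃ w, G.Adj v w ∧ c s(v, w) = k := by
  constructor
  · rintro ⟨e, he, ⟨w, rfl⟩, hk⟩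
    exact ⟨w, he, hk⟩
  · rintro ⟨w, hw, hk⟩
    exact ⟨s(v, w), hw, Sym2.mem_mk_left v w, hk⟩

/-- Orient each edge of the complete graph on the integers modulo `7` so that head minus tail is
a nonzero square; the color with parameter `a` is then `a * tail + (1 - a) * head`. -/
def paleyColor (a x y : Fin 7) : Fin 7 :=
  if y - x = 1 ∨ y - x = 2 ∨ y - x = 4 then a * x + (1 - a) * y else a * y + (1 - a) * x

theorem paleyColor_comm : ∀ a x y, paleyColor a x y = paleyColor a y x := by
  decide

/-- The three edge colorings given by the parameters `3`, `4` and `5`. -/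
def paleyColoring (i : Fin 3) : Sym2 (Fin 7) → ℕ :=
  Sym2.lift ⟨fun x y => paleyColor (![3, 4, 5] i) x y, fun x y =>
    congrArg Fin.val (paleyColor_comm _ x y)⟩

theorem paleyColoring_mk (i : Fin 3) (x y : Fin 7) :
    paleyColoring i s(x, y) = paleyColor (![3, 4, 5] i) x y :=
  rfl

theorem isProperEdgeColoring_paleyColoring (i : Fin 3) :
    IsProperEdgeColoring (completeGraph (Fin 7)) (paleyColoring i) := by
  apply isProperEdgeColoring_of_injective
  simp only [paleyColoring_mk, top_adj, Fin.val_inj]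
  revert i
  decide

/-- The only color missing at a vertex is the vertex itself. -/
theorem colorsAt_paleyColoring (i : Fin 3) (v : Fin 7) :
    colorsAt (completeGraph (Fin 7)) (paleyColoring i) v =
      Set.image Fin.val {k : Fin 7 | k ≠ v} := by
  have missing : ∀ i v w, v ≠ w → paleyColor (![3, 4, 5] i) v w ≠ v := by decide
  have surj : ∀ i v k, k ≠ v → ∃ w, v ≠ w ∧ paleyColor (![3, 4, 5] i) v w = k := by decide
  ext k
  rw [mem_colorsAt]
  constructor
  · rintro ⟨w, hw, rfl⟩
    exact ⟨_, missing i v w hw, rfl⟩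
  · rintro ⟨k, hk, rfl⟩
    obtain ⟨w, hw, rfl⟩ := surj i v k hk
    exact ⟨w, hw, rfl⟩

theorem isSimultaneousEdgeColoring_paleyColoring :
    IsSimultaneousEdgeColoring (completeGraph (Fin 7)) 3 paleyColoring := by
  refine ⟨isProperEdgeColoring_paleyColoring, fun i j v => ?_, fun i j hij e => ?_⟩
  · rw [colorsAt_paleyColoring, colorsAt_paleyColoring]
  · induction e with | _ x y
    simp only [mem_edgeSet, top_adj, paleyColoring_mk, ne_eq, Fin.val_inj]
    revert i j x y
    decide

/-- The complete graph `K₇` admits a `μ`-simultaneous edge coloring for `μ = 2` and `μ = 3`. -/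
theorem completeGraph_seven_simultaneousEdgeColorable :
    SimultaneousEdgeColorable (completeGraph (Fin 7)) 2 ∧
      SimultaneousEdgeColorable (completeGraph (Fin 7)) 3 :=
  have three : SimultaneousEdgeColorable (completeGraph (Fin 7)) 3 :=
    ⟨paleyColoring, isSimultaneousEdgeColoring_paleyColoring⟩
  ⟨three.mono (by decide), three⟩
end

section
/- For every positive integer n with n ∉ {2, 3, 5}, the complete graph K_n admits a μ-simultaneous edge coloring for μ = 2 and for μ = 3 (for μ = 3 one also needs n ≥ 4, since μ cannot exceed the minimum degree). -/
open SimpleGraph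

/-- Symmetric arrays of colors indexed by `V × V`, with irrelevant diagonal, that encode a
`μ`-simultaneous edge coloring of the complete graph on `V`. -/
structure IsSimultaneousArray {V C : Type*} (μ : ℕ) (f : Fin μ → V → V → C) : Prop where
  symm : ∀ i x y, f i x y = f i y x
  proper : ∀ i x y z, x ≠ y → x ≠ z → f i x y = f i x z → y = z
  colors : ∀ i j x y, x ≠ y → ∃ z, x ≠ z ∧ f j x z = f i x y
  disjoint : ∀ i j x y, x ≠ y → f i x y = f j x y → i = j

namespace IsSimultaneousArray

variable {V W C : Type*} {μ : ℕ}

theorem comp_injective {D : Type*} {f : Fin μ → V → V → C} (hf : IsSimultaneousArray μ f)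
    {g : C → D} (hg : Function.Injective g) :
    IsSimultaneousArray μ fun i x y => g (f i x y) where
  symm i x y := congrArg g (hf.symm i x y)
  proper i x y z hy hz h := hf.proper i x y z hy hz (hg h)
  colors i j x y h := by
    obtain ⟨z, hz, e⟩ := hf.colors i j x y h
    exact ⟨z, hz, congrArg g e⟩
  disjoint i j x y h e := hf.disjoint i j x y h (hg e)

theorem comp_equiv {f : Fin μ → V → V → C} (hf : IsSimultaneousArray μ f) (e : W ≃ V) :
    IsSimultaneousArray μ fun i x y => f i (e x) (e y) where
  symm i x y := hf.symm i _ _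
  proper i x y z hy hz h :=
    e.injective (hf.proper i _ _ _ (e.injective.ne hy) (e.injective.ne hz) h)
  colors i j x y h := by
    obtain ⟨z, hz, hc⟩ := hf.colors i j _ _ (e.injective.ne h)
    exact ⟨e.symm z, fun h' => hz (by simp [h']), by simpa using hc⟩
  disjoint i j x y h := hf.disjoint i j _ _ (e.injective.ne h)

theorem comp_castLE {ν : ℕ} (h : ν ≤ μ) {f : Fin μ → V → V → C}
    (hf : IsSimultaneousArray μ f) : IsSimultaneousArray ν fun i => f (Fin.castLE h i) where
  symm _ := hf.symm _
  proper _ := hf.proper _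
  colors _ _ := hf.colors _ _
  disjoint _ _ x y hxy e := Fin.castLE_injective h (hf.disjoint _ _ x y hxy e)

theorem simultaneousEdgeColorable {f : Fin μ → V → V → ℕ} (hf : IsSimultaneousArray μ f) :
    SimultaneousEdgeColorable (completeGraph V) μ := by
  refine ⟨fun i => Sym2.lift ⟨f i, hf.symm i⟩, fun i e₁ he₁ e₂ he₂ hne hv hc => ?_,
    fun i j v => ?_, fun i j hij e he hc => ?_⟩
  · obtain ⟨v, hv₁, hv₂⟩ := hv
    obtain ⟨y, rfl⟩ := Sym2.mem_iff_exists.mp hv₁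
    obtain ⟨z, rfl⟩ := Sym2.mem_iff_exists.mp hv₂
    exact hne (congrArg (fun w => s(v, w)) (hf.proper i v y z he₁ he₂ hc))
  · have key : ∀ i j : Fin μ, colorsAt (completeGraph V) (Sym2.lift ⟨f i, hf.symm i⟩) v ⊆
        colorsAt (completeGraph V) (Sym2.lift ⟨f j, hf.symm j⟩) v := by
      rintro i j k ⟨e, he, hv, rfl⟩
      obtain ⟨y, rfl⟩ := Sym2.mem_iff_exists.mp hv
      obtain ⟨z, hz, hc⟩ := hf.colors i j v y he
      exact ⟨s(v, z), hz, Sym2.mem_mk_left v z, hc⟩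
    exact (key i j).antisymm (key j i)
  · induction e with
    | h x y => exact hij (hf.disjoint i j x y he hc)

end IsSimultaneousArray

/-- The array on `V ⊕ W` built from arrays on `V` and `W` and a coloring of the edges
between them, using three disjoint sets of colors. -/
def joinArray {V W A B C : Type*} (f : V → V → A) (g : W → W → B) (h : V → W → C) :
    V ⊕ W → V ⊕ W → A ⊕ B ⊕ C
  | .inl x, .inl y => .inl (f x y)
  | .inr x, .inr y => .inr (.inl (g x y))
  | .inl x, .inr y => .inr (.inr (h x y))
  | .inr x, .inl y => .inr (.inr (h y x))

/-- Joins of simultaneous arrays along a simultaneous coloring of the complete bipartite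
graph. -/
theorem IsSimultaneousArray.join {V W A B C : Type*} {μ : ℕ} {f : Fin μ → V → V → A}
    {g : Fin μ → W → W → B} {h : Fin μ → V → W → C}
    (hf : IsSimultaneousArray μ f) (hg : IsSimultaneousArray μ g)
    (h_left : ∀ i x, Function.Injective (h i x))
    (h_right : ∀ i y, Function.Injective fun x => h i x y)
    (h_row : ∀ i j x y, ∃ z, h j x z = h i x y)
    (h_col : ∀ i j x y, ∃ z, h j z y = h i x y)
    (h_disj : ∀ i j x y, h i x y = h j x y → i = j) :
    IsSimultaneousArray μ fun i => joinArray (f i) (g i) (h i) where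
  symm i x y := by
    rcases x with x | x <;> rcases y with y | y
    · exact congrArg _ (hf.symm i x y)
    · rfl
    · rfl
    · exact congrArg _ (congrArg _ (hg.symm i x y))
  proper i x y z hy hz e := by
    rcases x with x | x <;> rcases y with y | y <;> rcases z with z | z <;>
      simp only [joinArray, Sum.inl.injEq, Sum.inr.injEq, reduceCtorEq, ne_eq] at hy hz e ⊢
    · exact hf.proper i x y z hy hz e
    · exact h_left i x e
    · exact h_right i x e
    · exact hg.proper i x y z hy hz e
  colors i j x y hxy := by
    rcases x with x | x <;> rcases y with y | y
    · obtain ⟨z, hz, e⟩ := hf.colors i j x y (fun e => hxy (congrArg _ e))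
      exact ⟨.inl z, by simpa using hz, by simpa [joinArray] using e⟩
    · obtain ⟨z, e⟩ := h_row i j x y
      exact ⟨.inr z, by simp, by simpa [joinArray] using e⟩
    · obtain ⟨z, e⟩ := h_col i j y x
      exact ⟨.inl z, by simp, by simpa [joinArray] using e⟩
    · obtain ⟨z, hz, e⟩ := hg.colors i j x y (fun e => hxy (congrArg _ e))
      exact ⟨.inr z, by simpa using hz, by simpa [joinArray] using e⟩
  disjoint i j x y hxy e := by
    rcases x with x | x <;> rcases y with y | y <;>
      simp only [joinArray, Sum.inl.injEq, Sum.inr.injEq, ne_eq] at hxy e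
    · exact hf.disjoint i j x y hxy e
    · exact h_disj i j x y e
    · exact h_disj i j y x e
    · exact hg.disjoint i j x y hxy e

/-- Arrays on `Fin a` and `Fin b` with `μ ≤ a ≤ b` give an array on `Fin (b + a)`. -/
theorem exists_isSimultaneousArray_add {μ a b : ℕ} (ha : μ ≤ a) (hab : a ≤ b)
    (hA : ∃ f : Fin μ → Fin a → Fin a → ℕ, IsSimultaneousArray μ f)
    (hB : ∃ f : Fin μ → Fin b → Fin b → ℕ, IsSimultaneousArray μ f) :
    ∃ f : Fin μ → Fin (b + a) → Fin (b + a) → ℕ, IsSimultaneousArray μ f := by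
  obtain ⟨f, hf⟩ := hA
  obtain ⟨g, hg⟩ := hB
  rcases Nat.eq_zero_or_pos a with rfl | ha0
  · exact ⟨g, hg⟩
  have : NeZero a := ⟨ha0.ne'⟩
  have : NeZero b := ⟨(ha0.trans_le hab).ne'⟩
  have key := hg.join hf
    (h := fun i (y : Fin b) (x : Fin a) => y + Fin.castLE hab (x + Fin.castLE ha i))
    (fun i y x x' e => add_right_cancel (Fin.castLE_injective hab (add_left_cancel e)))
    (fun i x y y' e => add_right_cancel e)
    (fun i j y x => ⟨x + Fin.castLE ha i - Fin.castLE ha j, by simp⟩)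
    (fun i j y x => ⟨y + Fin.castLE hab (x + Fin.castLE ha i)
      - Fin.castLE hab (x + Fin.castLE ha j), by simp⟩)
    (fun i j y x e => Fin.castLE_injective ha
      (add_left_cancel (Fin.castLE_injective hab (add_left_cancel e))))
  exact ⟨_, (key.comp_injective Encodable.encode_injective).comp_equiv finSumFinEquiv.symm⟩

/-- Cyclic shifts of the standard one-factorization of `K₄`. -/
theorem isSimultaneousArray_four :
    IsSimultaneousArray 3 fun (i : Fin 3) (x y : Fin 4) =>
      ((if x = 3 then 2 * y.val else if y = 3 then 2 * x.val else x.val + y.val) + i.val) % 3 := by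
  constructor <;> decide +kernel

/-- Cyclic shifts of the standard one-factorization of `K₆`. -/
theorem isSimultaneousArray_six :
    IsSimultaneousArray 3 fun (i : Fin 3) (x y : Fin 6) =>
      ((if x = 5 then 2 * y.val else if y = 5 then 2 * x.val else x.val + y.val) + i.val) % 5 := by
  constructor <;> decide +kernel

/-- Three cyclic near-one-factorizations of `K₇`. -/
theorem isSimultaneousArray_seven :
    IsSimultaneousArray 3 fun (i : Fin 3) (x y : Fin 7) =>
      (x + (![![0, 3, 6, 1, 5, 4, 2], ![0, 4, 1, 5, 2, 6, 3], ![0, 5, 3, 2, 6, 1, 4]] :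
        Fin 3 → Fin 7 → Fin 7) i (y - x)).val := by
  constructor <;> decide +kernel

/-- Three cyclic near-one-factorizations of `K₉`. -/
theorem isSimultaneousArray_nine :
    IsSimultaneousArray 3 fun (i : Fin 3) (x y : Fin 9) =>
      (x + (![![0, 2, 6, 8, 7, 3, 5, 4, 1], ![0, 3, 8, 7, 5, 1, 4, 6, 2],
        ![0, 4, 7, 2, 1, 6, 8, 5, 3]] : Fin 3 → Fin 9 → Fin 9) i (y - x)).val := by
  constructor <;> decide +kernel

theorem exists_isSimultaneousArray_three (n : ℕ) (hn : 4 ≤ n) (h5 : n ≠ 5) :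
    ∃ f : Fin 3 → Fin n → Fin n → ℕ, IsSimultaneousArray 3 f := by
  induction n using Nat.strong_induction_on with
  | _ n ih =>
    by_cases h : 8 ≤ n ∧ n ≠ 9
    · obtain ⟨m, rfl⟩ : ∃ m, n = m + 4 := ⟨n - 4, by omega⟩
      exact exists_isSimultaneousArray_add (by omega) (by omega)
        ⟨_, isSimultaneousArray_four⟩ (ih m (by omega) (by omega) (by omega))
    · obtain rfl | rfl | rfl | rfl : n = 4 ∨ n = 6 ∨ n = 7 ∨ n = 9 := by omega
      · exact ⟨_, isSimultaneousArray_four⟩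
      · exact ⟨_, isSimultaneousArray_six⟩
      · exact ⟨_, isSimultaneousArray_seven⟩
      · exact ⟨_, isSimultaneousArray_nine⟩

theorem isSimultaneousArray_of_subsingleton {V : Type*} [Subsingleton V] (μ : ℕ) :
    IsSimultaneousArray μ fun (_ : Fin μ) (_ _ : V) => 0 where
  symm _ _ _ := rfl
  proper _ _ _ _ _ _ _ := Subsingleton.elim _ _
  colors _ _ x y h := absurd (Subsingleton.elim x y) h
  disjoint _ _ x y h := absurd (Subsingleton.elim x y) h

/-- For every positive `n ∉ {2, 3, 5}`, the complete graph `Kₙ` admits a `2`-simultaneous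
edge coloring, and (when moreover `n ≥ 4`) a `3`-simultaneous edge coloring. -/
theorem completeGraph_simultaneousEdgeColorable
    (n : ℕ) (hn : 0 < n) (h2 : n ≠ 2) (h3 : n ≠ 3) (h5 : n ≠ 5) :
    SimultaneousEdgeColorable (completeGraph (Fin n)) 2 ∧
      (4 ≤ n → SimultaneousEdgeColorable (completeGraph (Fin n)) 3) := by
  obtain rfl | h4 : n = 1 ∨ 4 ≤ n := by omega
  · exact ⟨(isSimultaneousArray_of_subsingleton 2).simultaneousEdgeColorable, by omega⟩
  · obtain ⟨f, hf⟩ := exists_isSimultaneousArray_three n h4 h5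
    exact ⟨(hf.comp_castLE (Nat.le_succ 2)).simultaneousEdgeColorable,
      fun _ => hf.simultaneousEdgeColorable⟩
end

section
/- Let G be an r-regular graph and H an s-regular graph. If H is 1-factorable, then the Cartesian product G □ H is μ-simultaneous edge colorable for every μ ≤ r + s. -/
open SimpleGraph

/-- A graph is 1-factorable if its edge set can be partitioned into perfect matchings:
there is a coloring of its edges such that for every color and every vertex there is
exactly one edge of that color incident to the vertex. -/
def IsOneFactorable {V : Type*} (H : SimpleGraph V) : Prop :=
  ∃ (k : ℕ) (c : Sym2 V → Fin k),
    ∀ (i : Fin k) (v : V), ∃! e, e ∈ H.edgeSet ∧ v ∈ e ∧ c e = i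

/-- A finite connected graph of maximum degree at most two has at most two vertices of degree
at most one. -/
theorem SimpleGraph.Connected.not_three_degree_le_one {V : Type*} [Fintype V] [DecidableEq V]
    {G : SimpleGraph V} [DecidableRel G.Adj] (hG : G.Connected) (h2 : ∀ v, G.degree v ≤ 2)
    {x y z : V} (hxy : x ≠ y) (hxz : x ≠ z) (hyz : y ≠ z)
    (hx : G.degree x ≤ 1) (hy : G.degree y ≤ 1) (hz : G.degree z ≤ 1) : False := by
  have hcard := hG.card_vert_le_card_edgeSet_add_one
  rw [Nat.card_eq_fintype_card, Nat.card_eq_fintype_card, ← edgeFinset_card] at hcard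
  have hsum := G.sum_degrees_eq_twice_card_edges
  have hle : ∑ v, (G.degree v + if v ∈ ({x, y, z} : Finset V) then 1 else 0) ≤ ∑ _v : V, 2 := by
    refine Finset.sum_le_sum fun v _ => ?_
    have := h2 v
    split_ifs with h
    · simp only [Finset.mem_insert, Finset.mem_singleton] at h
      rcases h with rfl | rfl | rfl <;> omega
    · omega
  have h3 : ({x, y, z} : Finset V).card = 3 := Finset.card_eq_three.2 ⟨x, y, z, hxy, hxz, hyz, rfl⟩
  rw [Finset.sum_add_distrib, Finset.sum_boole, Finset.filter_mem_eq_inter, Finset.univ_inter,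
    h3, Finset.sum_const, Finset.card_univ, smul_eq_mul, hsum] at hle
  push_cast at hle
  omega

/-- A proper coloring of some of the edges of `G`, as a symmetric function on pairs of vertices;
the value `none` means that the pair is not colored. -/
structure IsPartialEdgeColoring {V κ : Type*} (G : SimpleGraph V) (c : V → V → Option κ) :
    Prop where
  symm : ∀ u v, c u v = c v u
  adj : ∀ u v, c u v ≠ none → G.Adj u v
  inj : ∀ u v w a, c u v = some a → c u w = some a → v = w

/-- The color `a` does not appear at the vertex `v`. -/
def Misses {V κ : Type*} (c : V → V → Option κ) (v : V) (a : κ) : Prop :=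
  ∀ w, c v w ≠ some a

/-- Give the edge `x y` the color `a`. -/
def recolor {V κ : Type*} [DecidableEq V] (c : V → V → Option κ) (x y : V) (a : κ) :
    V → V → Option κ :=
  fun u v => if (u = x ∧ v = y) ∨ (u = y ∧ v = x) then some a else c u v

/-- Swap the colors `a` and `b` at all vertices of `S`. -/
def swapOn {V κ : Type*} [DecidableEq κ] (c : V → V → Option κ) (S : Set V) [DecidablePred (· ∈ S)]
    (a b : κ) : V → V → Option κ :=
  fun u v => if u ∈ S then (c u v).map (Equiv.swap a b) else c u v

/-- The vertices `y 0, …, y m` are distinct, the edge `x (y 0)` is not colored, and the color of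
`x (y (i + 1))` is missing at `y i`. -/
structure IsFan {V κ : Type*} (c : V → V → Option κ) (x : V) (y : ℕ → V) (m : ℕ) : Prop where
  inj : ∀ i ≤ m, ∀ j ≤ m, y i = y j → i = j
  zero : c x (y 0) = none
  step : ∀ i < m, ∃ a, c x (y (i + 1)) = some a ∧ Misses c (y i) a

theorem IsFan.mono {V κ : Type*} {c : V → V → Option κ} {x : V} {y : ℕ → V} {m k : ℕ}
    (h : IsFan c x y m) (hk : k ≤ m) : IsFan c x y k :=
  ⟨fun i hi j hj => h.inj i (hi.trans hk) j (hj.trans hk), h.zero,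
    fun i hi => h.step i (hi.trans_le hk)⟩

/-- The subgraph of edges colored `a` or `b`. -/
def kempeGraph {V κ : Type*} {G : SimpleGraph V} {c : V → V → Option κ}
    (hc : IsPartialEdgeColoring G c) (a b : κ) : SimpleGraph V where
  Adj u v := c u v = some a ∨ c u v = some b
  symm := ⟨fun u v h => by rwa [hc.symm v u]⟩
  loopless := ⟨fun u h => (hc.adj u u (by rcases h with h | h <;> simp [h])).ne rfl⟩

namespace IsPartialEdgeColoring

variable {V κ : Type*} {G : SimpleGraph V} {c : V → V → Option κ}

theorem recolor [DecidableEq V] (hc : IsPartialEdgeColoring G c) {x y : V} {a : κ}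
    (hxy : G.Adj x y) (hx : Misses c x a) (hy : Misses c y a) :
    IsPartialEdgeColoring G (recolor c x y a) := by
  have hne := hxy.ne
  refine ⟨fun u v => ?_, fun u v h => ?_, fun u v w b hv hw => ?_⟩
  · have := hc.symm u v
    grind [_root_.recolor]
  · have := hc.adj u v
    have := hxy.symm
    grind [_root_.recolor]
  · have := hc.inj u v w b
    have := hx v
    have := hx w
    have := hy v
    have := hy w
    grind [_root_.recolor]

theorem swapOn [DecidableEq κ] (hc : IsPartialEdgeColoring G c) {a b : κ}
    (C : (kempeGraph hc a b).ConnectedComponent) [DecidablePred (· ∈ C.supp)] :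
    IsPartialEdgeColoring G (swapOn c C.supp a b) := by
  have hout : ∀ u v, u ∈ C.supp → v ∉ C.supp → c u v ≠ some a ∧ c u v ≠ some b := by
    intro u v hu hv
    refine not_or.1 fun h => hv ?_
    have hadj : (kempeGraph hc a b).Adj u v := h
    exact (C.mem_supp_congr_adj hadj).1 hu
  have hmap : ∀ u v, c u v ≠ some a → c u v ≠ some b →
      (c u v).map (Equiv.swap a b) = c u v := by
    intro u v ha hb
    cases h : c u v with
    | none => rfl
    | some d =>
      simp only [h, ne_eq, Option.some.injEq] at ha hb
      simp [Equiv.swap_apply_of_ne_of_ne ha hb]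
  refine ⟨fun u v => ?_, fun u v h => hc.adj u v ?_, fun u v w d hv hw => ?_⟩
  · unfold _root_.swapOn
    by_cases hu : u ∈ C.supp <;> by_cases hv : v ∈ C.supp <;> simp only [hu, hv, if_true, if_false]
    · rw [hc.symm]
    · rw [hmap u v (hout u v hu hv).1 (hout u v hu hv).2, hc.symm]
    · rw [hmap v u (hout v u hv hu).1 (hout v u hv hu).2, hc.symm]
    · rw [hc.symm]
  · unfold _root_.swapOn at h
    split_ifs at h
    · simpa using h
    · exact h
  · unfold _root_.swapOn at hv hw
    split_ifs at hv hw
    · obtain ⟨d₁, h₁, e₁⟩ := Option.map_eq_some_iff.1 hv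
      obtain ⟨d₂, h₂, e₂⟩ := Option.map_eq_some_iff.1 hw
      obtain rfl := (Equiv.swap a b).injective (e₁.trans e₂.symm)
      exact hc.inj u v w _ h₁ h₂
    · exact hc.inj u v w d hv hw

/-- Shifting colors along a fan colors its first edge. -/
theorem exists_extend_of_isFan [DecidableEq V] (m : ℕ) :
    ∀ {c : V → V → Option κ}, IsPartialEdgeColoring G c → ∀ {x : V} {y : ℕ → V} {a : κ},
    G.Adj x (y 0) → IsFan c x y m → Misses c x a → Misses c (y m) a →
    ∃ c' : V → V → Option κ, IsPartialEdgeColoring G c' ∧ c' x (y 0) ≠ none ∧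
      ∀ u v, c u v ≠ none → c' u v ≠ none := by
  induction m with
  | zero =>
    intro c hc x y a hadj _ hx hy
    exact ⟨_, hc.recolor hadj hx hy, by simp [_root_.recolor],
      fun u v h => by grind [_root_.recolor]⟩
  | succ m ih =>
    intro c hc x y a hadj hfan hx hy
    obtain ⟨b, hb, hmiss⟩ := hfan.step m (by omega)
    have hxy : G.Adj x (y (m + 1)) := hc.adj _ _ (by simp [hb])
    have hxm : ∀ i ≤ m, y i ≠ x := by
      intro i hi
      rcases i with _ | i
      · exact hadj.ne'
      · obtain ⟨d, hd, -⟩ := hfan.step i (by omega)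
        exact (hc.adj _ _ (by simp [hd])).ne'
    have hym : ∀ i ≤ m, y i ≠ y (m + 1) := fun i hi h => by
      have := hfan.inj i (by omega) (m + 1) le_rfl h
      omega
    have hab : a ≠ b := fun h => hx _ (h ▸ hb)
    have hkeep : ∀ i ≤ m, _root_.recolor c x (y (m + 1)) a x (y i) = c x (y i) := by
      intro i hi
      have := hym i hi
      have := hxm i hi
      grind [_root_.recolor]
    have hkeepMisses : ∀ i ≤ m, ∀ d, Misses c (y i) d →
        Misses (_root_.recolor c x (y (m + 1)) a) (y i) d := by
      intro i hi d hd w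
      have := hym i hi
      have := hxm i hi
      have := hd w
      grind [_root_.recolor]
    obtain ⟨c', hc', h0, hle⟩ := ih (hc.recolor hxy hx hy) (x := x) (y := y) (a := b) hadj
      ⟨fun i hi j hj => hfan.inj i (by omega) j (by omega),
        by rw [hkeep 0 (by omega), hfan.zero],
        fun i hi => by
          obtain ⟨d, hd, hmd⟩ := hfan.step i (by omega)
          exact ⟨d, by rw [hkeep _ (by omega), hd], hkeepMisses i (by omega) d hmd⟩⟩
      (fun w => by
        have := hc.inj x w (y (m + 1)) b
        grind [_root_.recolor])
      (hkeepMisses m le_rfl b hmiss)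
    exact ⟨c', hc', h0, fun u v h => hle u v (by grind [_root_.recolor])⟩

/-- At most two of the vertices of a Kempe component miss one of its two colors. -/
theorem not_three_misses [Fintype V] (hc : IsPartialEdgeColoring G c) {a b : κ}
    (C : (kempeGraph hc a b).ConnectedComponent) {x y z : V}
    (hxy : x ≠ y) (hxz : x ≠ z) (hyz : y ≠ z)
    (hxC : x ∈ C.supp) (hyC : y ∈ C.supp) (hzC : z ∈ C.supp)
    (hx : Misses c x a ∨ Misses c x b) (hy : Misses c y a ∨ Misses c y b)
    (hz : Misses c z a ∨ Misses c z b) : False := by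
  classical
  have hdeg : ∀ (v : C) (s : Finset (Option κ)), (∀ w, (kempeGraph hc a b).Adj v w → c v w ∈ s) →
      C.toSimpleGraph.degree v ≤ s.card := by
    intro v s hs
    rw [degree]
    have hadj : ∀ w ∈ C.toSimpleGraph.neighborFinset v, (kempeGraph hc a b).Adj v w :=
      fun w hw => (mem_neighborFinset C.toSimpleGraph _ _).1 hw
    refine Finset.card_le_card_of_injOn (fun w => c v w) (fun w hw => hs _ (hadj w hw)) ?_
    intro w hw w' hw' h
    refine Subtype.ext ?_
    rcases hadj w hw with h' | h'
    · exact hc.inj v w w' a h' (h.symm.trans h')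
    · exact hc.inj v w w' b h' (h.symm.trans h')
  have hdeg1 : ∀ v : C, Misses c v a ∨ Misses c v b → C.toSimpleGraph.degree v ≤ 1 := by
    rintro v (h | h)
    · exact hdeg v {some b} fun w hw => by simpa using hw.resolve_left (h w)
    · exact hdeg v {some a} fun w hw => by simpa using hw.resolve_right (h w)
  exact C.connected_toSimpleGraph.not_three_degree_le_one
    (fun v => (hdeg v {some a, some b} fun w hw => by
      simpa using show c v w = some a ∨ c v w = some b from hw).trans Finset.card_le_two)
    (x := ⟨x, hxC⟩) (y := ⟨y, hyC⟩) (z := ⟨z, hzC⟩)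
    (by simpa using hxy) (by simpa using hxz) (by simpa using hyz)
    (hdeg1 _ hx) (hdeg1 _ hy) (hdeg1 _ hz)

/-- If the last vertex of a fan at `x` misses `b`, the vertex `x` misses `a`, and swapping `a` and
`b` on the Kempe component of the last vertex preserves the fan, then its first edge can be
colored. -/
theorem exists_extend_of_swap (hc : IsPartialEdgeColoring G c) {x : V} {y : ℕ → V} {a b : κ}
    {m : ℕ} (hadj : G.Adj x (y 0)) (hfan : IsFan c x y m) (hx : Misses c x a)
    (hy : Misses c (y m) b)
    (hxC : x ∉ ((kempeGraph hc a b).connectedComponentMk (y m)).supp)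
    (hyC : ∀ i < m, c x (y (i + 1)) = some b →
      y i ∉ ((kempeGraph hc a b).connectedComponentMk (y m)).supp) :
    ∃ c' : V → V → Option κ, IsPartialEdgeColoring G c' ∧ c' x (y 0) ≠ none ∧
      ∀ u v, c u v ≠ none → c' u v ≠ none := by
  classical
  set C := (kempeGraph hc a b).connectedComponentMk (y m) with hC
  have hnot : ∀ u, u ∉ C.supp → ∀ v, _root_.swapOn c C.supp a b u v = c u v :=
    fun u hu v => if_neg hu
  have hmem : y m ∈ C.supp := ConnectedComponent.connectedComponentMk_mem
  obtain ⟨c', hc', h0, hle⟩ := (hc.swapOn C).exists_extend_of_isFan m (x := x) (y := y) (a := a)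
    hadj
    ⟨hfan.inj, by rw [hnot x hxC, hfan.zero], fun i hi => by
      obtain ⟨d, hd, hmd⟩ := hfan.step i hi
      refine ⟨d, by rw [hnot x hxC, hd], fun w => ?_⟩
      by_cases hi' : y i ∈ C.supp
      · have hda : d ≠ a := fun h => hx _ (h ▸ hd)
        have hdb : d ≠ b := fun h => hyC i hi (h ▸ hd) hi'
        simp only [_root_.swapOn, hi', if_true, ne_eq, Option.map_eq_some_iff, not_exists, not_and]
        intro e he h
        rw [Equiv.swap_apply_eq_iff, Equiv.swap_apply_of_ne_of_ne hda hdb] at h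
        exact hmd w (h ▸ he)
      · rw [hnot _ hi']
        exact hmd w⟩
    (fun w => by rw [hnot x hxC]; exact hx w)
    (fun w => by
      simp only [_root_.swapOn, hmem, if_true, ne_eq, Option.map_eq_some_iff, not_exists, not_and]
      intro e he h
      rw [Equiv.swap_apply_eq_iff, Equiv.swap_apply_left] at h
      exact hy w (h ▸ he))
  refine ⟨c', hc', h0, fun u v h => hle u v ?_⟩
  unfold _root_.swapOn
  split_ifs
  · simpa using h
  · exact h

/-- If every vertex misses a color, any uncolored edge can be added to the colored ones. -/
theorem exists_extend [Fintype V] (hc : IsPartialEdgeColoring G c)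
    (hmiss : ∀ v, ∃ a, Misses c v a) {x y₀ : V} (hadj : G.Adj x y₀) (h₀ : c x y₀ = none) :
    ∃ c' : V → V → Option κ, IsPartialEdgeColoring G c' ∧ c' x y₀ ≠ none ∧
      ∀ u v, c u v ≠ none → c' u v ≠ none := by
  classical
  by_contra hno
  obtain ⟨a, ha⟩ := hmiss x
  have hlonger : ∀ m, ∃ y : ℕ → V, y 0 = y₀ ∧ IsFan c x y m := by
    intro m
    induction m with
    | zero =>
      exact ⟨fun _ => y₀, rfl, fun i hi j hj _ => by omega, h₀, fun i hi => by omega⟩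
    | succ m ih =>
      obtain ⟨y, rfl, hfan⟩ := ih
      obtain ⟨b, hb⟩ := hmiss (y m)
      by_cases hbx : Misses c x b
      · exact (hno (hc.exists_extend_of_isFan m hadj hfan hbx hb)).elim
      obtain ⟨z, hz⟩ : ∃ z, c x z = some b := by simpa [Misses] using hbx
      by_cases hzy : ∃ i ≤ m, y i = z
      · exfalso
        obtain ⟨i, hi, rfl⟩ := hzy
        rcases i with _ | j
        · simp [h₀] at hz
        have hjb : Misses c (y j) b := by
          obtain ⟨d, hd, hmd⟩ := hfan.step j (by omega)
          rw [hz, Option.some.injEq] at hd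
          exact hd ▸ hmd
        have hxy : ∀ i ≤ m, x ≠ y i := by
          intro i hi
          rcases i with _ | i
          · exact hadj.ne
          · obtain ⟨d, hd, -⟩ := hfan.step i (by omega)
            exact (hc.adj _ _ (by simp [hd])).ne
        have honly : ∀ i < m, c x (y (i + 1)) = some b → i = j := fun i hi h => by
          have := hfan.inj _ (by omega) _ (by omega) (hc.inj _ _ _ _ h hz)
          omega
        set K := kempeGraph hc a b with hK
        by_cases hjx : x ∈ (K.connectedComponentMk (y j)).supp
        · have hmx : x ∉ (K.connectedComponentMk (y m)).supp := fun hmx => by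
            refine hc.not_three_misses (K.connectedComponentMk x) (hxy j (by omega))
              (hxy m le_rfl) (fun h => ?_) rfl hjx.symm hmx.symm (.inl ha) (.inr hjb) (.inr hb)
            have := hfan.inj j (by omega) m le_rfl h
            omega
          refine hno (hc.exists_extend_of_swap hadj hfan ha hb hmx fun i hi h hmem => hmx ?_)
          obtain rfl := honly i hi h
          exact hjx.trans hmem
        · refine hno (hc.exists_extend_of_swap hadj (hfan.mono (by omega)) ha hjb hjx
            fun i hi h => ?_)
          have := honly i (by omega) h
          omega
      · push Not at hzy
        refine ⟨Function.update y (m + 1) z, by simp, ?_, by simpa using h₀, ?_⟩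
        · intro i hi j hj h
          have := hfan.inj i
          have := hzy i
          have := hzy j
          grind [Function.update_apply]
        · intro i hi
          rw [Function.update_of_ne (by omega : i ≠ m + 1)]
          rcases Nat.lt_succ_iff_lt_or_eq.1 hi with hi | rfl
          · rw [Function.update_of_ne (by omega)]
            exact hfan.step i hi
          · exact ⟨b, by simpa using hz, hb⟩
  obtain ⟨y, -, hfan⟩ := hlonger (Fintype.card V)
  have := Finset.card_le_card_of_injOn (s := Finset.range (Fintype.card V + 1))
    (t := Finset.univ) y (fun _ _ => Finset.mem_univ _) (fun i hi j hj h =>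
      hfan.inj i (by simpa [Nat.lt_succ_iff] using hi) j (by simpa [Nat.lt_succ_iff] using hj) h)
  simp at this

end IsPartialEdgeColoring

/-- **Vizing's theorem**: if all degrees of a finite graph are at most `r`, its edges can be
properly colored with `r + 1` colors, and then every vertex misses a color. -/
theorem SimpleGraph.exists_edgeColoring_of_ncard_neighborSet_le {V : Type*} [Fintype V]
    (G : SimpleGraph V) {r : ℕ} (hG : ∀ v, (G.neighborSet v).ncard ≤ r) :
    ∃ (f : V → V → Fin (r + 1)) (a : V → Fin (r + 1)), (∀ u v, f u v = f v u) ∧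
      (∀ u v w, G.Adj u v → G.Adj u w → f u v = f u w → v = w) ∧
      ∀ u v, G.Adj u v → f u v ≠ a u := by
  classical
  have hmiss : ∀ c : V → V → Option (Fin (r + 1)), IsPartialEdgeColoring G c →
      ∀ v, ∃ a, Misses c v a := by
    intro c hc v
    by_contra! h
    simp only [Misses, ne_eq, not_forall, not_not] at h
    choose g hg using h
    have hle := Set.ncard_le_ncard_of_injOn (s := Set.univ) (t := G.neighborSet v) g
      (fun i _ => hc.adj _ _ (by simp [hg]))
      (fun i _ j _ h => by
        have hi := hg i
        rw [h, hg j, Option.some.injEq] at hi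
        exact hi.symm)
    rw [Set.ncard_univ, Nat.card_eq_fintype_card, Fintype.card_fin] at hle
    have := hG v
    omega
  let colored : (V → V → Option (Fin (r + 1))) → Finset (V × V) :=
    fun c => Finset.univ.filter fun p => c p.1 p.2 ≠ none
  obtain ⟨c, hc, hmax⟩ := Set.exists_max_image
    {c : V → V → Option (Fin (r + 1)) | IsPartialEdgeColoring G c} (fun c => (colored c).card)
    (Set.toFinite _) ⟨fun _ _ => none, by constructor <;> simp⟩
  have hall : ∀ u v, G.Adj u v → c u v ≠ none := by
    intro u v huv h
    obtain ⟨c', hc', h', hle⟩ := hc.exists_extend (hmiss c hc) huv h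
    refine (hmax c' hc').not_gt (Finset.card_lt_card ?_)
    refine Finset.ssubset_iff_of_subset ?_ |>.2 ⟨(u, v), ?_, ?_⟩
    · intro p hp
      simp only [colored, Finset.mem_filter, Finset.mem_univ, true_and] at hp ⊢
      exact hle _ _ hp
    · simpa [colored] using h'
    · simpa [colored] using h
  choose a ha using hmiss c hc
  have hget : ∀ u v, G.Adj u v → c u v = some ((c u v).getD 0) := fun u v h => by
    obtain ⟨d, hd⟩ := Option.ne_none_iff_exists'.1 (hall u v h)
    simp [hd]
  refine ⟨fun u v => (c u v).getD 0, a, fun u v => congrArg (Option.getD · 0) (hc.symm u v), ?_, ?_⟩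
  · intro u v w hv hw h
    exact hc.inj u v w _ (hget u v hv) (by rw [hget u w hw]; exact congrArg some h.symm)
  · intro u v huv h
    exact ha u v (by rw [hget u v huv]; exact congrArg some h)

/-- An `m`-regular graph with a proper edge coloring with `m` colors is `μ`-simultaneous edge
colorable for every `μ ≤ m`: shift the colors cyclically. -/
theorem SimultaneousEdgeColorable.of_regular {V : Type*} {G : SimpleGraph V} {m : ℕ}
    (hm : ∀ v, (G.neighborSet v).ncard = m) (d : V → V → ℕ) (hsymm : ∀ u v, d u v = d v u)
    (hlt : ∀ u v, G.Adj u v → d u v < m)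
    (hinj : ∀ u v w, G.Adj u v → G.Adj u w → d u v = d u w → v = w) {μ : ℕ} (hμ : μ ≤ m) :
    SimultaneousEdgeColorable G μ := by
  have hcancel : ∀ p < m, ∀ q < m, ∀ i, (p + i) % m = (q + i) % m → p = q := fun p hp q hq i h =>
    (Nat.ModEq.add_right_cancel' i h).eq_of_lt_of_lt hp hq
  let c : Fin μ → Sym2 V → ℕ := fun i => Sym2.lift ⟨fun u v => (d u v + i) % m,
    fun u v => by simp only [hsymm u v]⟩
  have hc : ∀ i u v, c i s(u, v) = (d u v + i) % m := fun _ _ _ => rfl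
  have hcolors : ∀ i v, colorsAt G (c i) v = {k | k < m} := by
    intro i v
    have himage : colorsAt G (c i) v = (fun w => (d v w + i) % m) '' G.neighborSet v := by
      ext k
      constructor
      · rintro ⟨e, he, hv, rfl⟩
        obtain ⟨w, rfl⟩ := hv
        exact ⟨w, he, rfl⟩
      · rintro ⟨w, hw, rfl⟩
        exact ⟨s(v, w), hw, Sym2.mem_mk_left v w, rfl⟩
    have hfin : {k | k < m}.Finite := Set.finite_lt_nat m
    refine Set.eq_of_subset_of_ncard_le ?_ ?_ hfin
    · rw [himage]
      rintro _ ⟨w, hw, rfl⟩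
      exact Nat.mod_lt _ ((Nat.zero_le _).trans_lt (hlt v w hw))
    · rw [himage, Set.InjOn.ncard_image, hm]
      · rw [show {k | k < m} = ((Finset.range m : Finset ℕ) : Set ℕ) by ext; simp,
          Set.ncard_coe_finset, Finset.card_range]
      · intro w hw w' hw' h
        exact hinj v w w' hw hw' (hcancel _ (hlt v w hw) _ (hlt v w' hw') i h)
  refine ⟨c, fun i => ?_, fun i j v => by rw [hcolors, hcolors], fun i j hij e he h => hij ?_⟩
  · rintro e₁ he₁ e₂ he₂ hne ⟨v, ⟨w₁, rfl⟩, w₂, rfl⟩ h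
    exact hne (by
      rw [hinj v w₁ w₂ he₁ he₂ (hcancel _ (hlt _ _ he₁) _ (hlt _ _ he₂) i h)])
  · induction e with
    | _ u v =>
      rw [hc, hc, add_comm, add_comm (d u v)] at h
      exact Fin.ext (hcancel _ (i.2.trans_le hμ) _ (j.2.trans_le hμ) _ h)

/-- If `G` is `r`-regular, `H` is `s`-regular and `H` is 1-factorable, then the Cartesian
product `G □ H` is `μ`-simultaneous edge colorable for every `μ ≤ r + s`. -/
theorem boxProd_simultaneousEdgeColorable_of_oneFactorable
    {V W : Type*} [Fintype V] [Fintype W] (G : SimpleGraph V) (H : SimpleGraph W)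
    (r s : ℕ) (hG : ∀ v : V, (G.neighborSet v).ncard = r)
    (hH : ∀ w : W, (H.neighborSet w).ncard = s) (hfac : IsOneFactorable H) :
    ∀ μ ≤ r + s, SimultaneousEdgeColorable (G.boxProd H) μ := by
  classical
  intro μ hμ
  obtain ⟨k, h, hh⟩ := hfac
  have hks : ∀ w : W, k ≤ s := by
    intro w
    choose e he _ using fun i => hh i w
    have hw : ∀ i, w ∈ e i := fun i => (he i).2.1
    choose g hg using hw
    have hle := Set.ncard_le_ncard_of_injOn (s := Set.univ) (t := H.neighborSet w) g
      (fun i _ => by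
        have := (he i).1
        rwa [hg i] at this)
      (fun i _ j _ hij => by
        have hi := (he i).2.2
        rw [hg i, hij, ← hg j, (he j).2.2] at hi
        exact hi.symm)
    rwa [Set.ncard_univ, Nat.card_eq_fintype_card, Fintype.card_fin, hH] at hle
  have hinjH : ∀ u v w, H.Adj u v → H.Adj u w → h s(u, v) = h s(u, w) → v = w :=
    fun u v w hv hw heq => Sym2.congr_right.1 <| (hh (h s(u, w)) u).unique
      ⟨hv, Sym2.mem_mk_left u v, heq⟩ ⟨hw, Sym2.mem_mk_left u w, rfl⟩
  obtain ⟨f, a, hfsymm, hfinj, hfa⟩ := G.exists_edgeColoring_of_ncard_neighborSet_le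
    fun v => (hG v).le
  let t : V → W → W → ℕ := fun v w w' =>
    if (h s(w, w') : ℕ) = 0 then a v else r + h s(w, w')
  let d : V × W → V × W → ℕ := fun p q => if p.1 = q.1 then t p.1 p.2 q.2 else f p.1 q.1
  have hdG : ∀ v v' w, G.Adj v v' → d (v, w) (v', w) = f v v' := fun v v' w hv => if_neg hv.ne
  have hdH : ∀ v w w', d (v, w) (v, w') = t v w w' := fun v w w' => if_pos rfl
  have ht : ∀ v v' w w', G.Adj v v' → (f v v' : ℕ) ≠ t v w w' := by
    intro v v' w w' hv heq
    simp only [t] at heq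
    split_ifs at heq with h0
    · exact hfa v v' hv (Fin.ext heq)
    · have := (f v v').2
      omega
  refine SimultaneousEdgeColorable.of_regular (m := r + s) ?_ d ?_ ?_ ?_ hμ
  · rintro ⟨v, w⟩
    rw [neighborSet_boxProd, Set.ncard_union_eq, Set.ncard_prod, Set.ncard_prod, hG, hH]
    · simp
    · rw [Set.disjoint_left]
      rintro ⟨v', w'⟩ ⟨h1, -⟩ ⟨h2, -⟩
      obtain rfl : v' = v := h2
      exact G.loopless.irrefl _ h1
  · rintro ⟨v, w⟩ ⟨v', w'⟩
    by_cases hv : v = v'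
    · subst hv
      simp only [d, t, Sym2.eq_swap (a := w)]
    · simp only [d, if_neg hv, if_neg (Ne.symm hv), hfsymm v]
  · rintro ⟨v, w⟩ ⟨v', w'⟩ hadj
    have hk := hks w
    have := (h s(w, w')).2
    rw [boxProd_adj] at hadj
    rcases hadj with ⟨hv, rfl : w = w'⟩ | ⟨hw, rfl : v = v'⟩
    · rw [hdG _ _ _ hv]
      have := (f v v').2
      omega
    · rw [hdH]
      have := (a v).2
      simp only [t]
      split_ifs <;> omega
  · rintro ⟨v, w⟩ ⟨v₁, w₁⟩ ⟨v₂, w₂⟩ h₁ h₂ heq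
    rw [boxProd_adj] at h₁ h₂
    rcases h₁ with ⟨hv₁, rfl : w = w₁⟩ | ⟨hw₁, rfl : v = v₁⟩ <;>
      rcases h₂ with ⟨hv₂, rfl : w = w₂⟩ | ⟨hw₂, rfl : v = v₂⟩
    · rw [hdG _ _ _ hv₁, hdG _ _ _ hv₂] at heq
      rw [hfinj v v₁ v₂ hv₁ hv₂ (Fin.ext heq)]
    · rw [hdG _ _ _ hv₁, hdH] at heq
      exact (ht _ _ _ _ hv₁ heq).elim
    · rw [hdG _ _ _ hv₂, hdH] at heq
      exact (ht _ _ _ _ hv₂ heq.symm).elim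
    · rw [hdH, hdH] at heq
      have := (a v).2
      refine congrArg (Prod.mk v) (hinjH w w₁ w₂ hw₁ hw₂ (Fin.ext ?_))
      simp only [t] at heq
      split_ifs at heq <;> omega
end

section
/- For all integers n ≥ 2 and m ≥ 3, the Cartesian product C_{2n} □ C_m of an even circuit of length 2n with a circuit of length m is μ-simultaneous edge colorable for every μ ≤ 4. -/
open SimpleGraph

/-- If `f` colors the edges with `0, 1, 2, 3` so that every vertex sees each of these colors on
exactly one incident edge, then the cyclic shifts of `f` form a simultaneous edge coloring. -/
theorem SimultaneousEdgeColorable.of_four_coloring {V : Type*} {G : SimpleGraph V}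
    (f : V → V → ℕ) (symm : ∀ u v, f u v = f v u)
    (lt : ∀ u v, G.Adj u v → f u v < 4)
    (inj : ∀ u v w, G.Adj u v → G.Adj u w → f u v = f u w → v = w)
    (surj : ∀ u, ∀ k < 4, ∃ v, G.Adj u v ∧ f u v = k) {μ : ℕ} (hμ : μ ≤ 4) :
    SimultaneousEdgeColorable G μ := by
  let c : Fin μ → Sym2 V → ℕ := fun i => Sym2.lift ⟨fun u v => (f u v + i) % 4,
    fun u v => by simp only [symm u v]⟩
  have hc : ∀ i u v, c i s(u, v) = (f u v + i) % 4 := fun _ _ _ => rfl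
  have colors : ∀ i v, colorsAt G (c i) v = {k | k < 4} := by
    intro i v
    ext k
    constructor
    · rintro ⟨e, -, hv, rfl⟩
      obtain ⟨w, rfl⟩ := hv
      rw [hc]
      exact Nat.mod_lt _ (by norm_num)
    · intro hk
      have hk : k < 4 := hk
      obtain ⟨w, hw, hf⟩ := surj v ((k + 4 - i) % 4) (Nat.mod_lt _ (by norm_num))
      refine ⟨s(v, w), hw, Sym2.mem_mk_left v w, ?_⟩
      rw [hc, hf]
      have := i.2
      omega
  refine ⟨c, fun i => ?_, fun i j v => by rw [colors, colors], fun i j hij e he => ?_⟩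
  · rintro e₁ h₁ e₂ h₂ hne ⟨v, ⟨a, rfl⟩, ⟨b, rfl⟩⟩ heq
    rw [hc, hc] at heq
    have ha := lt v a h₁
    have hb := lt v b h₂
    exact hne (by rw [inj v a b h₁ h₂ (by omega)])
  · induction e with
    | _ u v =>
      rw [hc, hc]
      have := i.2
      have := j.2
      have hij : (i : ℕ) ≠ j := fun h => hij (Fin.ext h)
      omega

/-- The product of a 1-factorized 2-regular graph with a 3-edge-colored 2-regular graph, where
`d` is the color missing at each vertex of the latter, is simultaneous edge colorable. -/
theorem SimultaneousEdgeColorable.boxProd {V W : Type*} {G : SimpleGraph V} {H : SimpleGraph W}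
    (f : V → V → ℕ) (f_symm : ∀ u v, f u v = f v u)
    (f_lt : ∀ u v, G.Adj u v → f u v < 2)
    (f_inj : ∀ u v w, G.Adj u v → G.Adj u w → f u v = f u w → v = w)
    (f_surj : ∀ u, ∀ k < 2, ∃ v, G.Adj u v ∧ f u v = k)
    (g : W → W → ℕ) (d : W → ℕ) (g_symm : ∀ u v, g u v = g v u)
    (g_lt : ∀ u v, H.Adj u v → g u v < 3) (d_lt : ∀ u, d u < 3)
    (g_ne : ∀ u v, H.Adj u v → g u v ≠ d u)
    (g_inj : ∀ u v w, H.Adj u v → H.Adj u w → g u v = g u w → v = w)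
    (g_surj : ∀ u, ∀ k < 3, k ≠ d u → ∃ v, H.Adj u v ∧ g u v = k) {μ : ℕ} (hμ : μ ≤ 4) :
    SimultaneousEdgeColorable (G.boxProd H) μ := by
  classical
  let c : V × W → V × W → ℕ := fun x y =>
    if x.2 = y.2 then if f x.1 y.1 = 0 then 3 else d x.2 else g x.2 y.2
  have c_left : ∀ a a' b, c (a, b) (a', b) = if f a a' = 0 then 3 else d b := by simp [c]
  have c_right : ∀ a b b', H.Adj b b' → c (a, b) (a, b') = g b b' := fun a b b' h => by
    simp [c, h.ne]
  refine of_four_coloring c ?_ ?_ ?_ ?_ hμ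
  · intro x y
    simp only [c, eq_comm (a := x.2), f_symm x.1, g_symm x.2]
    grind
  · rintro ⟨a, b⟩ ⟨a', b'⟩ h
    rw [boxProd_adj] at h
    obtain ⟨h, rfl : b = b'⟩ | ⟨h, rfl : a = a'⟩ := h
    · rw [c_left]
      grind
    · rw [c_right _ _ _ h]
      grind
  · rintro ⟨a, b⟩ ⟨a₁, b₁⟩ ⟨a₂, b₂⟩ h₁ h₂
    rw [boxProd_adj] at h₁ h₂
    obtain ⟨h₁, rfl : b = b₁⟩ | ⟨h₁, rfl : a = a₁⟩ := h₁ <;>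
    obtain ⟨h₂, rfl : b = b₂⟩ | ⟨h₂, rfl : a = a₂⟩ := h₂
    · rw [c_left, c_left]
      grind
    · rw [c_left, c_right _ _ _ h₂]
      grind
    · rw [c_left, c_right _ _ _ h₁]
      grind
    · rw [c_right _ _ _ h₁, c_right _ _ _ h₂]
      grind
  · rintro ⟨a, b⟩ k hk
    by_cases h₃ : k = 3
    · obtain ⟨a', h, hf⟩ := f_surj a 0 (by norm_num)
      exact ⟨(a', b), boxProd_adj.2 (.inl ⟨h, rfl⟩), by rw [c_left, if_pos hf, h₃]⟩
    by_cases hd : k = d b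
    · obtain ⟨a', h, hf⟩ := f_surj a 1 (by norm_num)
      exact ⟨(a', b), boxProd_adj.2 (.inl ⟨h, rfl⟩), by rw [c_left, if_neg (by omega), hd]⟩
    · obtain ⟨b', h, hg⟩ := g_surj b k (by omega) hd
      exact ⟨(a, b'), boxProd_adj.2 (.inr ⟨h, rfl⟩), by rw [c_right _ _ _ h, hg]⟩

theorem SimpleGraph.cycleGraph_adj_iff_val {n : ℕ} (hn : 3 ≤ n) (u v : Fin n) :
    (cycleGraph n).Adj u v ↔ (u : ℕ) + 1 = v ∨ (v : ℕ) + 1 = u ∨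
      (u = (0 : ℕ) ∧ (v : ℕ) + 1 = n) ∨ (v = (0 : ℕ) ∧ (u : ℕ) + 1 = n) := by
  have hu := u.2
  have hv := v.2
  rw [cycleGraph_adj', Fin.sub_def, Fin.sub_def]
  dsimp only
  rcases lt_trichotomy (u : ℕ) v with h | h | h
  · rw [Nat.mod_eq_of_lt (show n - v + u < n by omega),
      show n - (u : ℕ) + v = v - u + n by omega, Nat.add_mod_right, Nat.mod_eq_of_lt (by omega)]
    omega
  · rw [h, Nat.sub_add_cancel hv.le, Nat.mod_self]
    omega
  · rw [Nat.mod_eq_of_lt (show n - u + v < n by omega),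
      show n - (v : ℕ) + u = u - v + n by omega, Nat.add_mod_right, Nat.mod_eq_of_lt (by omega)]
    omega

/-- The edge coloring of a circuit that alternates `0` and `1` along the path `0, 1, …, n - 1`
and gives the closing edge the color `k`. -/
def cycleColor (k : ℕ) {n : ℕ} (u v : Fin n) : ℕ :=
  if (u : ℕ) + 1 = v then u % 2 else if (v : ℕ) + 1 = u then v % 2 else k

theorem cycleColor_symm (k : ℕ) {n : ℕ} (u v : Fin n) :
    cycleColor k u v = cycleColor k v u := by
  unfold cycleColor
  split_ifs <;> omega

theorem cycleColor_one_inj {n : ℕ} (hn : 2 ≤ n) (u v w : Fin (2 * n))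
    (hv : (cycleGraph (2 * n)).Adj u v) (hw : (cycleGraph (2 * n)).Adj u w)
    (h : cycleColor 1 u v = cycleColor 1 u w) : v = w := by
  rw [cycleGraph_adj_iff_val (by omega)] at hv hw
  unfold cycleColor at h
  apply Fin.ext
  split_ifs at h <;> omega

theorem exists_adj_cycleColor_one_eq {n : ℕ} (hn : 2 ≤ n) (u : Fin (2 * n)) (k : ℕ) (hk : k < 2) :
    ∃ v, (cycleGraph (2 * n)).Adj u v ∧ cycleColor 1 u v = k := by
  have hu := u.2
  simp only [cycleGraph_adj_iff_val (show 3 ≤ 2 * n by omega), cycleColor]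
  by_cases hp : (u : ℕ) % 2 = k
  · by_cases hl : (u : ℕ) + 1 = 2 * n
    · exact ⟨⟨0, by omega⟩, by dsimp only; omega, by dsimp only; split_ifs <;> omega⟩
    · exact ⟨⟨u + 1, by omega⟩, by dsimp only; omega, by dsimp only; split_ifs <;> omega⟩
  · by_cases h₀ : (u : ℕ) = 0
    · exact ⟨⟨2 * n - 1, by omega⟩, by dsimp only; omega, by dsimp only; split_ifs <;> omega⟩
    · exact ⟨⟨u - 1, by omega⟩, by dsimp only; omega, by dsimp only; split_ifs <;> omega⟩

theorem cycleColor_two_inj {m : ℕ} (hm : 3 ≤ m) (u v w : Fin m)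
    (hv : (cycleGraph m).Adj u v) (hw : (cycleGraph m).Adj u w)
    (h : cycleColor 2 u v = cycleColor 2 u w) : v = w := by
  rw [cycleGraph_adj_iff_val hm] at hv hw
  unfold cycleColor at h
  apply Fin.ext
  split_ifs at h <;> omega

/-- The color among `0, 1, 2` that `cycleColor 2` does not use at the vertex `u`. -/
def cycleMissingColor {m : ℕ} (u : Fin m) : ℕ :=
  if (u : ℕ) = 0 then 1 else if (u : ℕ) + 1 = m then (m + 1) % 2 else 2

theorem cycleMissingColor_lt {m : ℕ} (u : Fin m) : cycleMissingColor u < 3 := by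
  unfold cycleMissingColor
  split_ifs <;> omega

theorem cycleColor_two_ne_cycleMissingColor {m : ℕ} (hm : 3 ≤ m) (u v : Fin m)
    (h : (cycleGraph m).Adj u v) : cycleColor 2 u v ≠ cycleMissingColor u := by
  rw [cycleGraph_adj_iff_val hm] at h
  unfold cycleColor cycleMissingColor
  split_ifs <;> omega

theorem exists_adj_cycleColor_two_eq {m : ℕ} (hm : 3 ≤ m) (u : Fin m) (k : ℕ) (hk : k < 3)
    (hne : k ≠ cycleMissingColor u) : ∃ v, (cycleGraph m).Adj u v ∧ cycleColor 2 u v = k := by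
  have hu := u.2
  unfold cycleMissingColor at hne
  simp only [cycleGraph_adj_iff_val hm, cycleColor]
  by_cases h₂ : k = 2
  · by_cases h₀ : (u : ℕ) = 0
    · exact ⟨⟨m - 1, by omega⟩, by dsimp only; omega, by dsimp only; split_ifs <;> omega⟩
    · have hl : (u : ℕ) + 1 = m := by
        by_contra hl
        rw [if_neg h₀, if_neg hl] at hne
        exact hne h₂
      exact ⟨⟨0, by omega⟩, by dsimp only; omega,
        by dsimp only; rw [if_neg (by omega), if_neg (by omega), h₂]⟩
  by_cases hp : (u : ℕ) % 2 = k
  · exact ⟨⟨u + 1, by split_ifs at hne <;> omega⟩, by dsimp only; omega,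
      by dsimp only; split_ifs <;> omega⟩
  · exact ⟨⟨u - 1, by omega⟩, by dsimp only; split_ifs at hne <;> omega,
      by dsimp only; split_ifs at hne ⊢ <;> omega⟩

/-- For `n ≥ 2` and `m ≥ 3`, the Cartesian product `C_{2n} □ C_m` of circuits is
`μ`-simultaneous edge colorable for every `μ ≤ 4`. -/
theorem cycleGraph_boxProd_cycleGraph_simultaneousEdgeColorable
    (n m : ℕ) (hn : 2 ≤ n) (hm : 3 ≤ m) :
    ∀ μ ≤ 4, SimultaneousEdgeColorable ((cycleGraph (2 * n)).boxProd (cycleGraph m)) μ := by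
  intro μ hμ
  refine SimultaneousEdgeColorable.boxProd (cycleColor 1) (cycleColor_symm 1) ?_
    (cycleColor_one_inj hn) (exists_adj_cycleColor_one_eq hn) (cycleColor 2) cycleMissingColor
    (cycleColor_symm 2) ?_ cycleMissingColor_lt (cycleColor_two_ne_cycleMissingColor hm)
    (cycleColor_two_inj hm) (exists_adj_cycleColor_two_eq hm) hμ <;>
  · intro u v _
    unfold cycleColor
    split_ifs <;> omega
end

section
/- Let G be an r-regular graph and n ≥ 1 an integer. Then the Cartesian product G □ K_{2n} is μ-simultaneous edge colorable for every μ ≤ r + 2n − 1. -/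
open SimpleGraph

/-- A partial proper edge coloring of `G`: the color `a` is the matching joining each vertex `v`
to `partner a v`, where `partner a v = v` means that `a` is missing at `v`. -/
structure PartialEdgeColoring {V : Type*} (G : SimpleGraph V) (α : Type*) where
  partner : α → V → V
  involutive : ∀ a v, partner a (partner a v) = v
  inj : ∀ a b v, partner a v = partner b v → partner a v ≠ v → a = b
  adj : ∀ a v, partner a v ≠ v → G.Adj v (partner a v)

namespace PartialEdgeColoring

variable {V α : Type*} {G : SimpleGraph V}

/-- The pair `v`, `w` is joined by some color. -/
def Colored (σ : PartialEdgeColoring G α) (v w : V) : Prop := ∃ a, σ.partner a v = w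

/-- There is a coloring of all colored edges of `σ` together with `xy`. -/
def Extendable (σ : PartialEdgeColoring G α) (x y : V) : Prop :=
  ∃ σ' : PartialEdgeColoring G α,
    (∀ v w, v ≠ w → σ.Colored v w → σ'.Colored v w) ∧ σ'.Colored x y

lemma Extendable.of_colored {σ τ : PartialEdgeColoring G α} {x y : V} (h : τ.Extendable x y)
    (hστ : ∀ v w, v ≠ w → σ.Colored v w → τ.Colored v w) : σ.Extendable x y := by
  obtain ⟨ρ, h₁, h₂⟩ := h
  exact ⟨ρ, fun v w hvw h => h₁ v w hvw (hστ v w hvw h), h₂⟩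

/-- A Vizing fan at `x`, listed from its last vertex down to its first vertex `y₀`: each vertex
is joined to `x` by a color missing at its predecessor. -/
inductive Fan (σ : PartialEdgeColoring G α) (x y₀ : V) : List V → Prop
  | single : Fan σ x y₀ [y₀]
  | cons {y z : V} {l : List V} {e : α} (h : Fan σ x y₀ (y :: l)) (hz : z ∉ y :: l) (hzx : z ≠ x)
      (hx : σ.partner e x = z) (hy : σ.partner e y = y) : Fan σ x y₀ (z :: y :: l)

lemma Fan.nodup {σ : PartialEdgeColoring G α} {x y₀ : V} {l : List V} (h : σ.Fan x y₀ l) :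
    l.Nodup := by
  induction h with
  | single => simp
  | cons _ hz _ _ _ ih => exact List.nodup_cons.2 ⟨hz, ih⟩

lemma Fan.mono {σ τ : PartialEdgeColoring G α} {x y₀ : V} {l : List V} (h : σ.Fan x y₀ l)
    (hστ : ∀ f, σ.partner f x ∈ l → σ.partner f x ≠ x → τ.partner f = σ.partner f) :
    τ.Fan x y₀ l := by
  induction h with
  | single => exact .single
  | @cons y z l e h hz hzx hx hy ih =>
    have he : τ.partner e = σ.partner e := hστ e (by simp [hx]) (hx ▸ hzx)
    exact .cons (ih fun f hf => hστ f (List.mem_cons_of_mem _ hf)) hz hzx (he ▸ hx) (he ▸ hy)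

lemma Fan.of_suffix {σ τ : PartialEdgeColoring G α} {x y₀ : V} {l s : List V} (h : σ.Fan x y₀ l)
    (hs : s <:+ l) (hs' : τ.Fan x y₀ s)
    (hστ : ∀ f, σ.partner f x ∈ l → σ.partner f x ∉ s → σ.partner f x ≠ x →
      τ.partner f = σ.partner f) : τ.Fan x y₀ l := by
  induction h with
  | single => exact .single
  | @cons y z l e h hz hzx hx hy ih =>
    rcases List.suffix_cons_iff.1 hs with rfl | hs
    · exact hs'
    have hzs : z ∉ s := fun h => hz (hs.subset h)
    have he : τ.partner e = σ.partner e := hστ e (by simp [hx]) (hx ▸ hzs) (hx ▸ hzx)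
    exact .cons (ih hs fun f hf => hστ f (List.mem_cons_of_mem _ hf)) hz hzx (he ▸ hx) (he ▸ hy)

lemma Fan.exists_pred {σ : PartialEdgeColoring G α} {x y₀ z : V} {l : List V}
    (h : σ.Fan x y₀ l) (hz : z ∈ l) (hz₀ : z ≠ y₀) :
    ∃ u s e, (z :: u :: s) <:+ l ∧ σ.Fan x y₀ (u :: s) ∧ z ∉ u :: s ∧
      σ.partner e x = z ∧ σ.partner e u = u := by
  induction h with
  | single => simp_all
  | @cons y w l e h hw hwx hx hy ih =>
    rcases List.mem_cons.1 hz with rfl | hz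
    · exact ⟨y, l, e, List.suffix_rfl, h, hw, hx, hy⟩
    · obtain ⟨u, s, e, h₁, h₂⟩ := ih hz
      exact ⟨u, s, e, h₁.trans (List.suffix_cons _ _), h₂⟩

open Classical in
/-- A pair of vertices that both miss `a` can be joined by `a`. -/
lemma extendable_of_missing (σ : PartialEdgeColoring G α) {x y : V} {a : α} (hxy : G.Adj x y)
    (hx : σ.partner a x = x) (hy : σ.partner a y = y) (hu : ∀ f, σ.partner f x ≠ y) :
    σ.Extendable x y := by
  have hne := hxy.ne
  have hu' : ∀ f, σ.partner f y ≠ x := fun f h => hu f (by rw [← h, σ.involutive])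
  have hi := σ.involutive
  have hj := σ.inj
  have ha := σ.adj
  have hs := hxy.symm
  let p : α → V → V := fun f v => if f = a then (if v = x then y else if v = y then x else
    σ.partner a v) else σ.partner f v
  refine ⟨⟨p, ?_, ?_, ?_⟩, ?_, a, ?_⟩
  · intro f v; simp only [p]; grind
  · intro f g v; simp only [p]; grind
  · intro f v; simp only [p]; grind
  · rintro v w hvw ⟨f, rfl⟩
    refine ⟨f, ?_⟩
    simp only [p]; grind
  · simp [p]

open Classical in
/-- If the edge `xz` has color `e` and both ends miss `a`, it can be recolored to `a`. -/
lemma exists_recolor (σ : PartialEdgeColoring G α) {x z : V} {a e : α} (hzx : z ≠ x)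
    (he : σ.partner e x = z) (hx : σ.partner a x = x) (hz : σ.partner a z = z) :
    ∃ τ : PartialEdgeColoring G α, (∀ v w, v ≠ w → (τ.Colored v w ↔ σ.Colored v w)) ∧
      (∀ f, f ≠ a → f ≠ e → τ.partner f = σ.partner f) ∧ τ.partner e x = x ∧
      ∀ v, v ≠ z → σ.partner e v = v → τ.partner e v = v := by
  have hi := σ.involutive
  have hj := σ.inj
  have ha := σ.adj
  have hez : σ.partner e z = x := by rw [← he, hi]
  have hae : a ≠ e := by rintro rfl; exact hzx (he.symm.trans hx)
  let p : α → V → V := fun f v => if f = a then (if v = x then z else if v = z then x else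
    σ.partner a v) else if f = e then (if v = x ∨ v = z then v else σ.partner e v)
    else σ.partner f v
  refine ⟨⟨p, ?_, ?_, ?_⟩, ?_, ?_, ?_, ?_⟩
  · intro f v; simp only [p]; grind
  · intro f g v; simp only [p]; grind
  · intro f v; simp only [p]; grind
  · refine fun v w hvw => ⟨?_, ?_⟩
    · rintro ⟨f, rfl⟩
      by_cases h : f = a ∧ (v = x ∨ v = z)
      · refine ⟨e, ?_⟩; simp only [p]; grind
      · refine ⟨f, ?_⟩; simp only [p] at hvw ⊢; grind
    · rintro ⟨f, rfl⟩
      by_cases h : f = e ∧ (v = x ∨ v = z)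
      · refine ⟨a, ?_⟩; simp only [p]; grind
      · refine ⟨f, ?_⟩; simp only [p]; grind
  · intro f h₁ h₂; funext v; simp [p, h₁, h₂]
  · simp [p, hae.symm]
  · intro v h₁ h₂; simp only [p]; grind

/-- A fan whose last vertex misses a color that is also missing at `x` can be rotated. -/
lemma Fan.extendable {x y₀ : V} (hxy : G.Adj x y₀) {l : List V} {y : V}
    {σ : PartialEdgeColoring G α} (hu : ¬ σ.Colored x y₀) {a : α} (h : σ.Fan x y₀ (y :: l))
    (hx : σ.partner a x = x) (hy : σ.partner a y = y) : σ.Extendable x y₀ := by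
  induction l generalizing y σ a with
  | nil =>
    cases h
    exact σ.extendable_of_missing hxy hx hy fun f hf => hu ⟨f, hf⟩
  | cons w l ih =>
    cases h with
    | @cons _ _ _ e h hz hzx hex hew =>
      obtain ⟨τ, h₁, h₂, h₃, h₄⟩ := σ.exists_recolor hzx hex hx hy
      have hwy : w ≠ y := by rintro rfl; simp at hz
      refine Extendable.of_colored (ih (σ := τ) (a := e) ?_ ?_ h₃ (h₄ w hwy hew))
        fun v w hvw => (h₁ v w hvw).2
      · rwa [h₁ _ _ hxy.ne]
      · refine h.mono fun f hf hfx => h₂ f ?_ ?_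
        · rintro rfl; exact hfx hx
        · rintro rfl; exact hz (hex ▸ hf)

open Classical in
/-- Swapping the colors `a` and `b` on a set closed under both matchings. -/
lemma exists_swap (σ : PartialEdgeColoring G α) {a b : α} (hab : a ≠ b) (S : Set V)
    (hSa : ∀ v, σ.partner a v ∈ S ↔ v ∈ S) (hSb : ∀ v, σ.partner b v ∈ S ↔ v ∈ S) :
    ∃ τ : PartialEdgeColoring G α, (∀ v w, τ.Colored v w ↔ σ.Colored v w) ∧
      (∀ f, f ≠ a → f ≠ b → τ.partner f = σ.partner f) ∧
      (∀ v ∈ S, τ.partner a v = σ.partner b v ∧ τ.partner b v = σ.partner a v) ∧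
      ∀ v ∉ S, τ.partner b v = σ.partner b v := by
  have hi := σ.involutive
  have hj := σ.inj
  have ha := σ.adj
  let p : α → V → V := fun f v => if v ∈ S then σ.partner (Equiv.swap a b f) v
    else σ.partner f v
  have hS : ∀ f v, f = a ∨ f = b → (σ.partner f v ∈ S ↔ v ∈ S) := by
    rintro f v (rfl | rfl)
    exacts [hSa v, hSb v]
  refine ⟨⟨p, ?_, ?_, ?_⟩, ?_, ?_, ?_, ?_⟩
  · intro f v
    simp only [p, Equiv.swap_apply_def]; grind
  · intro f g v h h'
    by_cases hv : v ∈ S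
    · simp only [p, hv, if_true] at h h'
      exact (Equiv.swap a b).injective (hj _ _ _ h h')
    · simp only [p, hv, if_false] at h h'
      exact hj _ _ _ h h'
  · intro f v; simp only [p]; split_ifs <;> apply ha
  · refine fun v w => ⟨?_, ?_⟩
    · rintro ⟨f, rfl⟩
      by_cases hv : v ∈ S
      · exact ⟨Equiv.swap a b f, by simp [p, hv]⟩
      · exact ⟨f, by simp [p, hv]⟩
    · rintro ⟨f, rfl⟩
      by_cases hv : v ∈ S
      · exact ⟨Equiv.swap a b f, by simp [p, hv]⟩
      · exact ⟨f, by simp [p, hv]⟩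
  · intro f h₁ h₂; funext v; simp [p, Equiv.swap_apply_of_ne_of_ne h₁ h₂]
  · intro v hv; simp [p, hv]
  · intro v hv; simp [p, hv]

end PartialEdgeColoring

/-- For involutions `p` and `q` and a fixed point `x` of `p`, the orbit of `x` contains at most one
fixed point of `q`. -/
lemma exists_orbit_of_involutive {V : Type*} {p q : V → V} (hp : p.Involutive)
    (hq : q.Involutive) {x : V} (hx : p x = x) :
    ∃ S : Set V, x ∈ S ∧ (∀ v, p v ∈ S ↔ v ∈ S) ∧ (∀ v, q v ∈ S ↔ v ∈ S) ∧
      ∀ y ∈ S, ∀ z ∈ S, q y = y → q z = z → y = z := by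
  set P := hp.toPerm p with hP
  set Q := hq.toPerm q with hQ
  have hPP : P⁻¹ = P := by ext v; rw [Equiv.Perm.inv_eq_iff_eq]; exact (hp v).symm
  have hQQ : Q⁻¹ = Q := by ext v; rw [Equiv.Perm.inv_eq_iff_eq]; exact (hq v).symm
  set T := P * Q with hT
  have hTi : P * T * P⁻¹ = T⁻¹ := by
    rw [hT, mul_inv_rev, hPP, hQQ, ← mul_assoc]
    nth_rw 1 [← hPP]
    simp
  have hPT : ∀ k : ℤ, P ((T ^ k) x) = (T ^ (-k)) x := by
    intro k
    have h : P * T ^ k * P⁻¹ = T ^ (-k) := by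
      rw [← conj_zpow, hTi, inv_zpow, zpow_neg]
    have hPx : P x = x := hx
    rw [← h, hPP, Equiv.Perm.mul_apply, Equiv.Perm.mul_apply, hPx]
  have hQT : ∀ k : ℤ, Q ((T ^ k) x) = (T ^ (-(k + 1))) x := by
    intro k
    rw [← hPT, add_comm, zpow_add, zpow_one]
    simp only [Equiv.Perm.mul_apply, hT]
    exact (hp _).symm
  have hpS : ∀ v, v ∈ {w | ∃ k : ℤ, (T ^ k) x = w} → p v ∈ {w | ∃ k : ℤ, (T ^ k) x = w} := by
    rintro _ ⟨k, rfl⟩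
    exact ⟨-k, (hPT k).symm⟩
  have hqS : ∀ v, v ∈ {w | ∃ k : ℤ, (T ^ k) x = w} → q v ∈ {w | ∃ k : ℤ, (T ^ k) x = w} := by
    rintro _ ⟨k, rfl⟩
    exact ⟨-(k + 1), (hQT k).symm⟩
  refine ⟨{w | ∃ k : ℤ, (T ^ k) x = w}, ⟨0, by simp⟩,
    fun v => ⟨fun h => hp v ▸ hpS _ h, hpS v⟩, fun v => ⟨fun h => hq v ▸ hqS _ h, hqS v⟩, ?_⟩
  have key : ∀ k : ℤ, q ((T ^ k) x) = (T ^ k) x → T ^ (2 * k + 1) ∈ MulAction.stabilizer _ x := by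
    intro k h
    have h' := (hQT k).symm.trans h
    rw [MulAction.mem_stabilizer_iff, Equiv.Perm.smul_def,
      show 2 * k + 1 = (k + 1) + k by ring, zpow_add, Equiv.Perm.mul_apply, ← h',
      ← Equiv.Perm.mul_apply, ← zpow_add]
    simp
  rintro _ ⟨k, rfl⟩ _ ⟨l, rfl⟩ hk hl
  have h₁ := key k hk
  have h₂ := key l hl
  have h₃ : T ^ (k - l) ∈ MulAction.stabilizer (Equiv.Perm V) x := by
    have := mul_mem (zpow_mem h₁ (-l)) (zpow_mem h₂ k)
    rw [← zpow_mul, ← zpow_mul, ← zpow_add] at this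
    convert this using 2
    ring
  rw [MulAction.mem_stabilizer_iff, Equiv.Perm.smul_def] at h₃
  conv_lhs => rw [show k = l + (k - l) by ring, zpow_add, Equiv.Perm.mul_apply, h₃]

namespace PartialEdgeColoring

variable {V α : Type*} {G : SimpleGraph V}

/-- A fan whose last vertex misses the color `b` of an edge from `x` into the fan can be used
after a Kempe swap. -/
lemma Fan.extendable_of_mem {x y₀ y : V} (hxy : G.Adj x y₀) {l : List V}
    {σ : PartialEdgeColoring G α} (hu : ¬ σ.Colored x y₀) {a b : α} (h : σ.Fan x y₀ (y :: l))
    (hx : σ.partner a x = x) (hy : σ.partner b y = y) (hbx : σ.partner b x ≠ x)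
    (hb : σ.partner b x ∈ y :: l) : σ.Extendable x y₀ := by
  obtain ⟨u, s, e, hs, hfan, hzs, hez, heu⟩ := h.exists_pred hb fun h => hu ⟨b, h⟩
  obtain rfl : e = b := σ.inj _ _ _ hez (hez ▸ hbx)
  have hae : a ≠ e := by rintro rfl; exact hbx hx
  have huy : u ≠ y := by
    rintro rfl
    rcases List.suffix_cons_iff.1 hs with h' | h'
    · have := (List.cons.inj h').1
      apply hbx
      conv_lhs => rw [this, ← hy, ← this, σ.involutive]
    · exact (List.nodup_cons.1 h.nodup).1 (h'.subset (by simp))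
  obtain ⟨S, hxS, hSa, hSe, hS⟩ := exists_orbit_of_involutive (σ.involutive a) (σ.involutive e) hx
  obtain ⟨τ, h₁, h₂, h₃, h₄⟩ := σ.exists_swap hae S hSa hSe
  have hτs : τ.Fan x y₀ (u :: s) := hfan.mono fun f hf hfx => h₂ f
    (by rintro rfl; exact hfx hx) (by rintro rfl; exact hzs hf)
  have hτu : ¬ τ.Colored x y₀ := by rwa [h₁]
  have hτx : τ.partner e x = x := (h₃ x hxS).2.trans hx
  refine Extendable.of_colored (τ := τ) ?_ fun v w _ => (h₁ v w).2
  by_cases huS : u ∈ S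
  · have hyS : y ∉ S := fun hyS => huy (hS u huS y hyS heu hy)
    have hτ : τ.Fan x y₀ (σ.partner e x :: u :: s) :=
      .cons hτs hzs hbx (h₃ x hxS).1 ((h₃ u huS).1.trans heu)
    refine Fan.extendable hxy hτu (h.of_suffix hs hτ fun f _ hf hfx => h₂ f ?_ ?_) hτx
      ((h₄ y hyS).trans hy)
    · rintro rfl; exact hfx hx
    · rintro rfl; exact hf (by simp)
  · exact Fan.extendable hxy hτu hτs hτx ((h₄ u huS).trans heu)

lemma extendable [Fintype V] {x y₀ : V} (hxy : G.Adj x y₀) (σ : PartialEdgeColoring G α)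
    (hm : ∀ v, ∃ a, σ.partner a v = v) : σ.Extendable x y₀ := by
  by_cases hu : σ.Colored x y₀
  · exact ⟨σ, fun _ _ _ h => h, hu⟩
  obtain ⟨a, ha⟩ := hm x
  have main : ∀ (k : ℕ) (y : V) (l : List V), Fintype.card V ≤ l.length + k →
      σ.Fan x y₀ (y :: l) → σ.Extendable x y₀ := by
    intro k
    induction k with
    | zero =>
      intro y l hl h
      have := h.nodup.length_le_card
      simp at this
      omega
    | succ k ih =>
      intro y l hl h
      obtain ⟨b, hb⟩ := hm y
      by_cases hbx : σ.partner b x = x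
      · exact h.extendable hxy hu hbx hb
      by_cases hz : σ.partner b x ∈ y :: l
      · exact h.extendable_of_mem hxy hu ha hb hbx hz
      · exact ih _ (y :: l) (by simp; omega) (.cons h hz hbx rfl hb)
  exact main (Fintype.card V) y₀ [] (by simp) .single

lemma exists_missing [Fintype V] [Fintype α] (σ : PartialEdgeColoring G α) (v : V)
    (h : (G.neighborSet v).ncard < Fintype.card α) : ∃ a, σ.partner a v = v := by
  by_contra! hne
  have : Function.Injective fun a => σ.partner a v := fun a b hab => σ.inj a b v hab (hne a)
  have h' := Set.ncard_le_ncard (s := Set.range fun a => σ.partner a v) (t := G.neighborSet v)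
    (by rintro _ ⟨a, rfl⟩; exact σ.adj a v (hne a)) (Set.toFinite _)
  rw [Set.ncard_range_of_injective this, Nat.card_eq_fintype_card] at h'
  omega

/-- **Vizing's theorem**: more colors than the maximum degree suffice to color every edge. -/
theorem exists_forall_colored [Fintype V] [Fintype α]
    (h : ∀ v, (G.neighborSet v).ncard < Fintype.card α) :
    ∃ σ : PartialEdgeColoring G α, ∀ v w, G.Adj v w → σ.Colored v w := by
  classical
  have main : ∀ s : Finset (V × V), (∀ e ∈ s, G.Adj e.1 e.2) →
      ∃ σ : PartialEdgeColoring G α, ∀ e ∈ s, σ.Colored e.1 e.2 := by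
    intro s
    induction s using Finset.induction_on with
    | empty => exact fun _ => ⟨⟨fun _ v => v, by simp, by simp, by simp⟩, by simp⟩
    | insert e s _ ih =>
      intro hs
      obtain ⟨σ, hσ⟩ := ih fun e he => hs e (Finset.mem_insert_of_mem he)
      obtain ⟨τ, h₁, h₂⟩ := σ.extendable (hs e (Finset.mem_insert_self _ _))
        fun v => σ.exists_missing v (h v)
      refine ⟨τ, fun f hf => ?_⟩
      rcases Finset.mem_insert.1 hf with rfl | hf'
      · exact h₂
      · exact h₁ _ _ (hs f hf).ne (hσ f hf')
  obtain ⟨σ, hσ⟩ := main {e | G.Adj e.1 e.2} (by simp)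
  exact ⟨σ, fun v w hvw => hσ (v, w) (by simpa using hvw)⟩

end PartialEdgeColoring

lemma ncard_neighborSet_eq_degree {V : Type*} (H : SimpleGraph V) (v : V)
    [Fintype (H.neighborSet v)] : (H.neighborSet v).ncard = H.degree v := by
  rw [← Nat.card_coe_set_eq, Nat.card_eq_fintype_card, card_neighborSet_eq_degree]

/-- A regular graph of positive degree `d` with a proper edge coloring by `d` colors has a
`μ`-simultaneous edge coloring for every `μ ≤ d`, by cyclically shifting the colors. -/
lemma simultaneousEdgeColorable_of_regular {V : Type*} (H : SimpleGraph V) {d μ : ℕ}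
    (hd : 0 < d) (hμ : μ ≤ d) (hH : ∀ v, (H.neighborSet v).ncard = d) (F : V → V → ℕ)
    (hF : ∀ v w, H.Adj v w → F v w < d) (hsymm : ∀ v w, H.Adj v w → F v w = F w v)
    (hinj : ∀ v w w', H.Adj v w → H.Adj v w' → F v w = F v w' → w = w') :
    SimultaneousEdgeColorable H μ := by
  classical
  let c : Sym2 V → ℕ := Sym2.lift ⟨fun v w => if H.Adj v w then F v w else 0, fun v w => by
    by_cases h : H.Adj v w
    · simp [h, h.symm, hsymm v w h]
    · simp [h, mt SimpleGraph.Adj.symm h]⟩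
  have hc : ∀ v w, H.Adj v w → c s(v, w) = F v w := fun v w h => by simp [c, h]
  have hmod : ∀ i a b, a < d → b < d → (a + i) % d = (b + i) % d → a = b := fun i a b ha hb h =>
    Nat.ModEq.eq_of_lt_of_lt (Nat.ModEq.add_right_cancel' i h) ha hb
  have hcolors : ∀ i : ℕ, ∀ v, colorsAt H (fun e => (c e + i) % d) v = Set.Iio d := by
    intro i v
    have himg : colorsAt H (fun e => (c e + i) % d) v =
        (fun w => (F v w + i) % d) '' H.neighborSet v := by
      ext k
      constructor
      · rintro ⟨e, he, hv, hk⟩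
        obtain ⟨w, rfl⟩ := hv
        exact ⟨w, he, by rw [← hk]; simp only [hc v w he]⟩
      · rintro ⟨w, hw, hk⟩
        exact ⟨s(v, w), hw, by simp, by rw [← hk]; simp only [hc v w hw]⟩
    rw [himg]
    refine Set.eq_of_subset_of_ncard_le ?_ ?_ (Set.finite_Iio d)
    · rintro _ ⟨w, -, rfl⟩
      exact Nat.mod_lt _ hd
    · rw [Set.InjOn.ncard_image, hH]
      · simp [Set.ncard_eq_toFinset_card']
      · intro w hw w' hw' h
        exact hinj v w w' hw hw' (hmod i _ _ (hF v w hw) (hF v w' hw') h)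
  refine ⟨fun i e => (c e + i) % d, ?_, ?_, ?_⟩
  · rintro i e₁ h₁ e₂ h₂ hne ⟨v, ⟨w, rfl⟩, ⟨w', rfl⟩⟩ h
    simp only [hc v w h₁, hc v w' h₂] at h
    exact hne (by rw [hinj v w w' h₁ h₂ (hmod i _ _ (hF v w h₁) (hF v w' h₂) h)])
  · intro i j v
    rw [hcolors i v, hcolors j v]
  · intro i j hij e _ h
    refine hij (Fin.ext (hmod (c e) i j (by omega) (by omega) ?_))
    simpa only [add_comm] using h

/-- The complete graph on `2n` vertices has a proper edge coloring with `2n - 1` colors. -/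
lemma exists_completeGraph_edgeColoring (n : ℕ) (hn : 1 ≤ n) :
    ∃ h : Fin (2 * n) → Fin (2 * n) → ℕ, (∀ i j, h i j < 2 * n - 1) ∧ (∀ i j, h i j = h j i) ∧
      ∀ i j k, i ≠ j → i ≠ k → h i j = h i k → j = k := by
  set m := 2 * n - 1 with hm
  have hcop : Nat.gcd m 2 = 1 := by
    rw [Nat.gcd_comm]; exact (Nat.coprime_two_left (n := m)).2 ⟨n - 1, by omega⟩
  have hadd : ∀ i a b, a < m → b < m → (i + a) % m = (i + b) % m → a = b := fun i a b ha hb h =>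
    Nat.ModEq.eq_of_lt_of_lt (Nat.ModEq.add_left_cancel' i h) ha hb
  have hdbl : ∀ a b, a < m → b < m → (a + a) % m = (b + b) % m → a = b := fun a b ha hb h => by
    refine Nat.ModEq.eq_of_lt_of_lt (Nat.ModEq.cancel_left_of_coprime hcop (c := 2) ?_) ha hb
    rw [two_mul, two_mul]; exact h
  refine ⟨fun i j => if i.val = m then (j + j) % m else if j.val = m then (i + i) % m
    else (i + j) % m, fun i j => ?_, fun i j => ?_, fun i j k hij hik h => ?_⟩
  · dsimp only
    split_ifs <;> exact Nat.mod_lt _ (by omega)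
  · dsimp only
    split_ifs with h₁ h₂
    · rw [h₁, h₂]
    · rfl
    · rfl
    · rw [add_comm]
  · have hi := i.isLt
    have hj := j.isLt
    have hk := k.isLt
    rw [ne_eq, Fin.ext_iff] at hij hik
    ext
    dsimp only at h
    split_ifs at h with h₁ h₂ h₃ h₃
    · exact hdbl _ _ (by omega) (by omega) h
    · omega
    · exact absurd (hadd i i k (by omega) (by omega) h) hik
    · exact absurd (hadd i j i (by omega) (by omega) h).symm hij
    · exact hadd i _ _ (by omega) (by omega) h

/-- If `G` is `r`-regular and `n ≥ 1`, then `G □ K_{2n}` is `μ`-simultaneous edge colorable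
for every `μ ≤ r + 2n - 1`. -/
theorem boxProd_completeGraph_simultaneousEdgeColorable
    {V : Type*} [Fintype V] (G : SimpleGraph V) (r n : ℕ) (hn : 1 ≤ n)
    (hG : ∀ v : V, (G.neighborSet v).ncard = r) :
    ∀ μ ≤ r + 2 * n - 1,
      SimultaneousEdgeColorable (G.boxProd (completeGraph (Fin (2 * n)))) μ := by
  classical
  intro μ hμ
  have hcard : ∀ v, (G.neighborSet v).ncard < Fintype.card (Fin (r + 1)) := by simp [hG]
  obtain ⟨σ, hσ⟩ := PartialEdgeColoring.exists_forall_colored hcard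
  choose! f hf using hσ
  choose m hm using fun v => σ.exists_missing v (hcard v)
  obtain ⟨h, hlt, hsymm, hinj⟩ := exists_completeGraph_edgeColoring n hn
  have hfm : ∀ v w, G.Adj v w → f v w ≠ m v := fun v w hvw h' =>
    hvw.ne ((hm v).symm.trans (h' ▸ hf v w hvw))
  have hfs : ∀ v w, G.Adj v w → f v w = f w v := fun v w hvw => by
    have h₁ : σ.partner (f v w) w = v := by
      have h₀ := σ.involutive (f v w) v
      rwa [hf v w hvw] at h₀
    have h₂ := hf w v hvw.symm
    exact σ.inj _ _ w (h₁.trans h₂.symm) (h₁.trans_ne hvw.ne)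
  have hfi : ∀ v w w', G.Adj v w → G.Adj v w' → f v w = f v w' → w = w' := fun v w w' h₁ h₂ h =>
    (hf v w h₁).symm.trans (h ▸ hf v w' h₂)
  refine simultaneousEdgeColorable_of_regular _ (by omega) hμ ?_
    (fun p q => if p.1 = q.1 then (if h p.2 q.2 = 0 then m p.1 else r + h p.2 q.2)
      else f p.1 q.1) ?_ ?_ ?_
  · intro v
    rw [completeGraph_eq_top, ncard_neighborSet_eq_degree, degree_boxProd,
      ← ncard_neighborSet_eq_degree, hG, complete_graph_degree, Fintype.card_fin]
    omega
  · intro p q hpq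
    have := hlt p.2 q.2
    have := (m p.1).isLt
    have := (f p.1 q.1).isLt
    split_ifs <;> omega
  · rintro ⟨v, i⟩ ⟨w, j⟩ hpq
    have := hfs v w
    simp only [boxProd_adj, completeGraph_eq_top, top_adj] at hpq
    dsimp only
    rw [hsymm j i]
    grind
  · rintro ⟨v, i⟩ ⟨w, j⟩ ⟨w', j'⟩ h₁ h₂ h₃
    simp only [boxProd_adj, completeGraph_eq_top, top_adj] at h₁ h₂ h₃
    have := (m v).isLt
    have := (f v w).isLt
    have := (f v w').isLt
    have := hfm v w
    have := hfm v w'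
    have := hfi v w w'
    have := hinj i j j'
    rw [Fin.ext_iff] at *
    grind [SimpleGraph.irrefl]
end

section
/- Let G be a bridgeless bipartite graph that is not 2-simultaneous edge colorable, such that every bridgeless bipartite graph with fewer edges than G is 2-simultaneous edge colorable, and every bridgeless bipartite graph with the same number of edges as G and more vertices than G is 2-simultaneous edge colorable. Then G is 2-connected. -/
open SimpleGraph

/-- The edge cut determined by a vertex set `S`: all edges with one endpoint in `S`
and the other in its complement. -/
def cutEdges {V : Type*} (G : SimpleGraph V) (S : Set V) : Set (Sym2 V) :=
  {e | e ∈ G.edgeSet ∧ ∃ a ∈ S, ∃ b ∈ Sᶜ, e = s(a, b)}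

/-- `G` is `k`-edge-connected: it is connected and every edge cut has at least `k` edges. -/
def IsKEdgeConnected {V : Type*} (G : SimpleGraph V) (k : ℕ) : Prop :=
  G.Connected ∧ ∀ S : Set V, S.Nonempty → Sᶜ.Nonempty → k ≤ (cutEdges G S).ncard

/-- `G` is 2-connected: connected, at least 3 vertices, and no cut vertex. -/
def IsTwoConnected {V : Type} [Fintype V] (G : SimpleGraph V) : Prop :=
  G.Connected ∧ 3 ≤ Fintype.card V ∧ ∀ v : V, (G.induce ({v}ᶜ : Set V)).Connected

/-- The union of two edge-disjoint simultaneously edge colorable graphs is simultaneously edge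
colorable. -/
theorem SimultaneousEdgeColorable.sup {V : Type*} {H₁ H₂ : SimpleGraph V} {μ : ℕ}
    (hd : Disjoint H₁.edgeSet H₂.edgeSet) (h₁ : SimultaneousEdgeColorable H₁ μ)
    (h₂ : SimultaneousEdgeColorable H₂ μ) : SimultaneousEdgeColorable (H₁ ⊔ H₂) μ := by
  classical
  obtain ⟨c₁, p₁, s₁, d₁⟩ := h₁
  obtain ⟨c₂, p₂, s₂, d₂⟩ := h₂
  rw [Set.disjoint_left] at hd
  let c : Fin μ → Sym2 V → ℕ :=
    fun i e => if e ∈ H₁.edgeSet then 2 * c₁ i e else 2 * c₂ i e + 1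
  have hc₁ : ∀ i, ∀ e ∈ H₁.edgeSet, c i e = 2 * c₁ i e := fun i e he => if_pos he
  have hc₂ : ∀ i, ∀ e ∈ H₂.edgeSet, c i e = 2 * c₂ i e + 1 :=
    fun i e he => if_neg fun h => hd h he
  have hcol : ∀ i v, colorsAt (H₁ ⊔ H₂) (c i) v =
      (2 * ·) '' colorsAt H₁ (c₁ i) v ∪ (2 * · + 1) '' colorsAt H₂ (c₂ i) v := by
    intro i v
    ext k
    simp only [colorsAt, edgeSet_sup, Set.mem_union, Set.mem_image, Set.mem_ofPred_eq]
    constructor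
    · rintro ⟨e, he | he, hv, rfl⟩
      · exact Or.inl ⟨_, ⟨e, he, hv, rfl⟩, (hc₁ i e he).symm⟩
      · exact Or.inr ⟨_, ⟨e, he, hv, rfl⟩, (hc₂ i e he).symm⟩
    · rintro (⟨_, ⟨e, he, hv, rfl⟩, rfl⟩ | ⟨_, ⟨e, he, hv, rfl⟩, rfl⟩)
      · exact ⟨e, Or.inl he, hv, hc₁ i e he⟩
      · exact ⟨e, Or.inr he, hv, hc₂ i e he⟩
  refine ⟨c, fun i => ?_, fun i j v => ?_, fun i j hij e he => ?_⟩
  · intro e₁ he₁ e₂ he₂ hne hv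
    rw [edgeSet_sup] at he₁ he₂
    rcases he₁ with he₁ | he₁ <;> rcases he₂ with he₂ | he₂
    · have := p₁ i e₁ he₁ e₂ he₂ hne hv
      rw [hc₁ i e₁ he₁, hc₁ i e₂ he₂]; omega
    · rw [hc₁ i e₁ he₁, hc₂ i e₂ he₂]; omega
    · rw [hc₂ i e₁ he₁, hc₁ i e₂ he₂]; omega
    · have := p₂ i e₁ he₁ e₂ he₂ hne hv
      rw [hc₂ i e₁ he₁, hc₂ i e₂ he₂]; omega
  · rw [hcol, hcol, s₁ i j, s₂ i j]
  · rw [edgeSet_sup] at he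
    rcases he with he | he
    · have := d₁ i j hij e he
      rw [hc₁ i e he, hc₁ j e he]; omega
    · have := d₂ i j hij e he
      rw [hc₂ i e he, hc₂ j e he]; omega

/-- Simultaneous edge colorability is preserved when a graph is embedded in a larger vertex
type. -/
theorem SimultaneousEdgeColorable.map {V W : Type*} {H : SimpleGraph W} {μ : ℕ} (f : W ↪ V)
    (h : SimultaneousEdgeColorable H μ) : SimultaneousEdgeColorable (H.map f) μ := by
  classical
  obtain ⟨c, p, s, d⟩ := h
  have hinj := Sym2.map.injective f.injective
  let c' : Fin μ → Sym2 V → ℕ := fun i => Function.extend (Sym2.map f) (c i) 0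
  have hc' : ∀ i e, c' i (Sym2.map f e) = c i e := fun i e => hinj.extend_apply _ _ _
  have hE : ∀ e, e ∈ (H.map f).edgeSet ↔ ∃ e' ∈ H.edgeSet, Sym2.map f e' = e := by
    intro e
    rw [edgeSet_map]
    rfl
  refine ⟨c', fun i => ?_, fun i j v => ?_, fun i j hij e he => ?_⟩
  · intro e₁ he₁ e₂ he₂ hne hv
    obtain ⟨e₁, hH₁, rfl⟩ := (hE _).1 he₁
    obtain ⟨e₂, hH₂, rfl⟩ := (hE _).1 he₂
    rw [hc', hc']
    refine p i e₁ hH₁ e₂ hH₂ (fun h => hne (h ▸ rfl)) ?_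
    obtain ⟨v, hv₁, hv₂⟩ := hv
    obtain ⟨w, hw, rfl⟩ := Sym2.mem_map.1 hv₁
    obtain ⟨w', hw', hww⟩ := Sym2.mem_map.1 hv₂
    exact ⟨w, hw, f.injective hww ▸ hw'⟩
  · have key : ∀ i j, colorsAt (H.map f) (c' i) v ⊆ colorsAt (H.map f) (c' j) v := by
      rintro i j k ⟨e, he, hv, rfl⟩
      obtain ⟨e, hH, rfl⟩ := (hE _).1 he
      obtain ⟨w, hw, rfl⟩ := Sym2.mem_map.1 hv
      have hk : c i e ∈ colorsAt H (c i) w := ⟨e, hH, hw, rfl⟩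
      rw [s i j] at hk
      obtain ⟨e', he', hw', hk⟩ := hk
      exact ⟨_, (hE _).2 ⟨e', he', rfl⟩, Sym2.mem_map.2 ⟨w, hw', rfl⟩, by rw [hc', hc', hk]⟩
    exact (key i j).antisymm (key j i)
  · obtain ⟨e, hH, rfl⟩ := (hE _).1 he
    rw [hc', hc']
    exact d i j hij e hH

theorem cutEdges_compl {V : Type*} (G : SimpleGraph V) (S : Set V) :
    cutEdges G Sᶜ = cutEdges G S := by
  ext e
  simp only [cutEdges, Set.mem_ofPred_eq, compl_compl]
  constructor
  · rintro ⟨he, a, ha, b, hb, rfl⟩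
    exact ⟨he, b, hb, a, ha, Sym2.eq_swap⟩
  · rintro ⟨he, a, ha, b, hb, rfl⟩
    exact ⟨he, b, hb, a, ha, Sym2.eq_swap⟩

theorem IsKEdgeConnected.of_le_ncard_cutEdges {V : Type*} [Nonempty V] {G : SimpleGraph V}
    {k : ℕ} (hk : k ≠ 0)
    (h : ∀ S : Set V, S.Nonempty → Sᶜ.Nonempty → k ≤ (cutEdges G S).ncard) :
    IsKEdgeConnected G k := by
  refine ⟨⟨fun x y => ?_⟩, h⟩
  by_contra hxy
  have hcut := h {z | G.Reachable x z} ⟨x, Reachable.refl x⟩ ⟨y, hxy⟩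
  have hempty : cutEdges G {z | G.Reachable x z} = ∅ := by
    rw [Set.eq_empty_iff_forall_notMem]
    rintro _ ⟨he, a, ha, b, hb, rfl⟩
    exact hb (Reachable.trans ha (Adj.reachable he))
  rw [hempty, Set.ncard_empty] at hcut
  omega

/-- A subgraph of a `k`-edge-connected graph induced on a vertex set that is attached to the
rest of the graph only at one vertex is again `k`-edge-connected. -/
theorem IsKEdgeConnected.comap {V W : Type*} [Finite W] {G : SimpleGraph V} {k : ℕ}
    (hk : k ≠ 0) (hG : IsKEdgeConnected G k) (f : W ↪ V) (w : W)
    (hf : ∀ x, x ≠ w → ∀ y, G.Adj (f x) y → y ∈ Set.range f) :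
    IsKEdgeConnected (G.comap f) k := by
  have : Nonempty W := ⟨w⟩
  refine .of_le_ncard_cutEdges hk ?_
  have key : ∀ S : Set W, w ∉ S → S.Nonempty → k ≤ (cutEdges (G.comap f) S).ncard := by
    intro S hw hS
    refine (hG.2 (f '' S) (hS.image f) ⟨f w, fun h => ?_⟩).trans ?_
    · obtain ⟨x, hx, hxw⟩ := h
      exact hw (f.injective hxw ▸ hx)
    · refine (Set.ncard_le_ncard (t := Sym2.map f '' cutEdges (G.comap f) S) ?_
        (Set.toFinite _)).trans (Set.ncard_image_le (Set.toFinite _))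
      rintro _ ⟨he, _, ⟨x, hx, rfl⟩, y, hy, rfl⟩
      obtain ⟨y, rfl⟩ := hf x (fun h => hw (h ▸ hx)) y he
      exact ⟨s(x, y), ⟨he, x, hx, y, fun h => hy ⟨y, h, rfl⟩, rfl⟩, rfl⟩
  intro S hS hS'
  by_cases hw : w ∈ S
  · rw [← cutEdges_compl]
    exact key _ (fun h => h hw) hS'
  · exact key S hw hS

theorem ncard_edgeSet_comap_lt {V W : Type*} [Finite V] {G : SimpleGraph V} (f : W ↪ V)
    {x y : V} (hxy : G.Adj x y) (hx : x ∉ Set.range f) :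
    (G.comap f).edgeSet.ncard < G.edgeSet.ncard := by
  rw [← Set.ncard_image_of_injective _ (Sym2.map.injective f.injective)]
  refine Set.ncard_lt_ncard ?_ (Set.toFinite _)
  rw [Set.ssubset_iff_of_subset]
  · refine ⟨s(x, y), hxy, ?_⟩
    rintro ⟨e, -, he⟩
    obtain ⟨w, -, hw⟩ := Sym2.mem_map.1 (he ▸ Sym2.mem_mk_left x y)
    exact hx ⟨w, hw⟩
  · rintro _ ⟨e, he, rfl⟩
    induction e with
    | h a b => exact he

/-- If `G` is a bridgeless bipartite graph such that every bridgeless bipartite graph with fewer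
edges is 2-simultaneous edge colorable, then so is the part of `G` on a proper vertex subset `T` attached only at `v`. -/
theorem exists_simultaneousEdgeColorable_of_attached {V : Type*} [Finite V] {G : SimpleGraph V}
    (hG : IsKEdgeConnected G 2) (hbip : G.Colorable 2)
    (hmin : ∀ (k : ℕ) (G' : SimpleGraph (Fin k)), IsKEdgeConnected G' 2 →
      G'.Colorable 2 → G'.edgeSet.ncard < G.edgeSet.ncard → SimultaneousEdgeColorable G' 2)
    {T : Set V} {v u : V} (hv : v ∈ T) (hu : u ∉ T)
    (hT : ∀ x ∈ T, x ≠ v → ∀ y, G.Adj x y → y ∈ T) :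
    ∃ H : SimpleGraph V, (∀ x y, H.Adj x y ↔ G.Adj x y ∧ x ∈ T ∧ y ∈ T) ∧
      SimultaneousEdgeColorable H 2 := by
  obtain ⟨k, ⟨e⟩⟩ := Finite.exists_equiv_fin T
  let f : Fin k ↪ V := e.symm.toEmbedding.trans (Function.Embedding.subtype _)
  have hf : ∀ x ∈ T, ∃ i, f i = x := fun x hx => ⟨e ⟨x, hx⟩, by simp [f]⟩
  have hfT : ∀ i, f i ∈ T := fun i => (e.symm i).2
  obtain ⟨w, hw⟩ := hf v hv
  have : Nontrivial V := ⟨v, u, fun h => hu (h ▸ hv)⟩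
  obtain ⟨y, hy⟩ := hG.1.preconnected.exists_adj_of_nontrivial u
  refine ⟨(G.comap f).map f, fun x y => ?_, (hmin k (G.comap f) ?_ ?_ ?_).map f⟩
  · rw [map_adj]
    constructor
    · rintro ⟨i, j, hij, rfl, rfl⟩
      exact ⟨hij, hfT i, hfT j⟩
    · rintro ⟨hxy, hx, hy⟩
      obtain ⟨i, rfl⟩ := hf x hx
      obtain ⟨j, rfl⟩ := hf y hy
      exact ⟨i, j, hxy, rfl, rfl⟩
  · refine hG.comap two_ne_zero f w fun x hx y hxy => ?_
    exact hf y (hT _ (hfT x) (fun h => hx (f.injective (h.trans hw.symm))) y hxy)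
  · obtain ⟨C⟩ := hbip
    exact ⟨C.comp (Embedding.comap f G).toHom⟩
  · refine ncard_edgeSet_comap_lt f hy ?_
    rintro ⟨i, rfl⟩
    exact hu (hfT i)

theorem three_le_card_of_isKEdgeConnected_two {V : Type*} [Fintype V] [Nontrivial V]
    {G : SimpleGraph V} (hG : IsKEdgeConnected G 2) : 3 ≤ Fintype.card V := by
  by_contra! hcard
  obtain ⟨a, b, hab⟩ := exists_pair_ne V
  have huniv : ∀ x, x = a ∨ x = b := by
    classical
    by_contra! hx
    obtain ⟨x, hxa, hxb⟩ := hx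
    have h3 := Finset.card_le_univ ({x, a, b} : Finset V)
    rw [Finset.card_eq_three.2 ⟨x, a, b, hxa, hxb, hab, rfl⟩] at h3
    omega
  have hcut := hG.2 {a} ⟨a, rfl⟩ ⟨b, fun h => hab h.symm⟩
  have hle : (cutEdges G {a}).ncard ≤ ({s(a, b)} : Set (Sym2 V)).ncard := by
    refine Set.ncard_le_ncard ?_ (Set.toFinite _)
    rintro _ ⟨-, x, rfl, y, hy, rfl⟩
    rcases huniv y with rfl | rfl
    · exact absurd rfl hy
    · rfl
  rw [Set.ncard_singleton] at hle
  omega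

/-- A counterexample to the strong SE conjecture with the minimum number of edges and,
among those, the maximum number of vertices, is 2-connected. -/
theorem extremal_counterexample_twoConnected
    {V : Type} [Fintype V] (G : SimpleGraph V)
    (hbridgeless : IsKEdgeConnected G 2) (hbip : G.Colorable 2)
    (hnotSE : ¬ SimultaneousEdgeColorable G 2)
    (hminEdges : ∀ (k : ℕ) (G' : SimpleGraph (Fin k)), IsKEdgeConnected G' 2 →
      G'.Colorable 2 → G'.edgeSet.ncard < G.edgeSet.ncard →
      SimultaneousEdgeColorable G' 2)
    (hmaxVerts : ∀ (k : ℕ) (G' : SimpleGraph (Fin k)), IsKEdgeConnected G' 2 →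
      G'.Colorable 2 → G'.edgeSet.ncard = G.edgeSet.ncard → Fintype.card V < k →
      SimultaneousEdgeColorable G' 2)
    : IsTwoConnected G := by
  have : Nontrivial V := by
    by_contra hV
    rw [not_nontrivial_iff_subsingleton] at hV
    have hE : G.edgeSet = ∅ := by rw [Subsingleton.elim G ⊥, edgeSet_bot]
    refine hnotSE ⟨fun _ _ => 0, ?_, fun _ _ _ => rfl, ?_⟩ <;>
      simp [IsProperEdgeColoring, hE]
  have hcard := three_le_card_of_isKEdgeConnected_two hbridgeless
  refine ⟨hbridgeless.1, hcard, fun v => ?_⟩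
  obtain ⟨w, hw⟩ := exists_ne v
  have : Nonempty ({v}ᶜ : Set V) := ⟨⟨w, hw⟩⟩
  refine ⟨fun a b => ?_⟩
  by_contra hab
  let A : Set V := {x | ∃ h : x ∈ ({v}ᶜ : Set V), (G.induce {v}ᶜ).Reachable a ⟨x, h⟩}
  have hA : ∀ x ∈ A, ∀ y, G.Adj x y → y ≠ v → y ∈ A := by
    rintro x ⟨hx, hax⟩ y hxy hy
    exact ⟨hy, hax.trans (Adj.reachable (G := G.induce {v}ᶜ) (u := ⟨x, hx⟩) (v := ⟨y, hy⟩) hxy)⟩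
  have hvA : v ∉ A := fun ⟨h, _⟩ => h rfl
  have haA : (a : V) ∈ A := ⟨a.2, Reachable.refl a⟩
  have hbA : (b : V) ∉ A := fun ⟨_, h⟩ => hab h
  obtain ⟨H₁, hH₁, hc₁⟩ := exists_simultaneousEdgeColorable_of_attached hbridgeless hbip
    hminEdges (T := insert v A) (v := v) (u := b) (Set.mem_insert _ _)
    (fun h => h.elim b.2 hbA) (by
      rintro x (rfl | hx) hxv y hxy
      · exact absurd rfl hxv
      · by_cases hy : y = v
        · exact Or.inl hy
        · exact Or.inr (hA x hx y hxy hy))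
  obtain ⟨H₂, hH₂, hc₂⟩ := exists_simultaneousEdgeColorable_of_attached hbridgeless hbip
    hminEdges (T := Aᶜ) (v := v) (u := a) hvA (fun h => h haA)
    (fun x hx hxv y hxy hy => hx (hA y hy x hxy.symm hxv))
  refine hnotSE ?_
  have hG : G = H₁ ⊔ H₂ := by
    ext x y
    rw [sup_adj, hH₁, hH₂]
    constructor
    · intro hxy
      by_cases hx : x ∈ A
      · by_cases hy : y = v
        · exact Or.inl ⟨hxy, Or.inr hx, Or.inl hy⟩
        · exact Or.inl ⟨hxy, Or.inr hx, Or.inr (hA x hx y hxy hy)⟩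
      · by_cases hy : y ∈ A
        · by_cases hxv : x = v
          · exact Or.inl ⟨hxy, Or.inl hxv, Or.inr hy⟩
          · exact absurd (hA y hy x hxy.symm hxv) hx
        · exact Or.inr ⟨hxy, hx, hy⟩
    · rintro (h | h) <;> exact h.1
  rw [hG]
  refine hc₁.sup ?_ hc₂
  rw [Set.disjoint_left]
  intro e
  induction e with
  | h x y =>
    intro h₁ h₂
    obtain ⟨hxy, hx₁, hy₁⟩ := (hH₁ x y).1 h₁
    obtain ⟨-, hx₂, hy₂⟩ := (hH₂ x y).1 h₂
    exact hxy.ne ((hx₁.resolve_right hx₂).trans (hy₁.resolve_right hy₂).symm)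
end
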